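/- Let d ≥ 3, λ = (d−2)/2, and let 1 ≤ p ≤ p_λ := 1 + λ/(λ + 2). Then there exists a constant C > 0 such that for every integer n ≥ 1 and every f ∈ L²(S^{d-1}, σ), ‖proj_n f‖_2 ≤ C · n^{(2λ+1)(1/p − 1/2) − 1/2} · ‖f‖_p. -/

import Mathlib

open MeasureTheory Metric
open scoped ENNReal

noncomputable section

/-- The unit sphere `S^{d-1}` in `ℝ^d`. -/
abbrev Sph (d : ℕ) := Metric.sphere (0 : EuclideanSpace ℝ (Fin d)) 1

/-- The surface measure `σ` on the unit sphere in `ℝ^d`. -/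
def sphMeasure (d : ℕ) : Measure (Sph d) :=
  (volume : Measure (EuclideanSpace ℝ (Fin d))).toSphere

/-- `Y : S^{d-1} → ℝ` is a spherical harmonic of degree `n` if it is the restriction to
`S^{d-1}` of a polynomial in `d` real variables that is homogeneous of degree `n` and
harmonic (the sum of its second partial derivatives vanishes identically). -/
def IsSphericalHarmonic (d n : ℕ) (Y : Sph d → ℝ) : Prop :=
  ∃ P : MvPolynomial (Fin d) ℝ, P.IsHomogeneous n ∧
    (∑ i : Fin d, MvPolynomial.pderiv i (MvPolynomial.pderiv i P)) = 0 ∧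
    ∀ x : Sph d, Y x = MvPolynomial.eval (fun i => (x : EuclideanSpace ℝ (Fin d)) i) P

/-- `H_k^d`: the subspace of `L²(S^{d-1}, σ)` consisting of (equivalence classes of)
spherical harmonics of degree `k`. -/
def Hspace (d k : ℕ) : Submodule ℝ (Lp ℝ 2 (sphMeasure d)) :=
  Submodule.span ℝ {f : Lp ℝ 2 (sphMeasure d) |
    ∃ Y : Sph d → ℝ, IsSphericalHarmonic d k Y ∧ ⇑f =ᵐ[sphMeasure d] Y}

/-- `T` is the orthogonal projection of `L²(S^{d-1}, σ)` onto `H_k^d`: it maps into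
`H_k^d` and `f - T f` is orthogonal to `H_k^d` for every `f`. -/
def IsOrthProjOnto (d k : ℕ)
    (T : Lp ℝ 2 (sphMeasure d) → Lp ℝ 2 (sphMeasure d)) : Prop :=
  ∀ f : Lp ℝ 2 (sphMeasure d), T f ∈ Hspace d k ∧
    ∀ g ∈ Hspace d k, @inner ℝ _ _ (f - T f) g = 0

/-- The constant `c_n = (Γ(d/2)/(2π^{d/2})) ((d+2n-2)/(d+n-2)) Γ(d+n-1)/(Γ(n+1)Γ(d-1))`. -/
def cCoef (d n : ℕ) : ℝ :=
  Real.Gamma ((d : ℝ) / 2) / (2 * Real.pi ^ ((d : ℝ) / 2)) *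
    (((d : ℝ) + 2 * (n : ℝ) - 2) / ((d : ℝ) + (n : ℝ) - 2)) *
    (Real.Gamma ((d : ℝ) + (n : ℝ) - 1) /
      (Real.Gamma ((n : ℝ) + 1) * Real.Gamma ((d : ℝ) - 1)))

/-- The operator `T_n f = ∑_{j=0}^{d-2} (-1)^j binom(d-2, j) (c_n / c_{n+2j}) proj_{n+2j} f`
on `L²(S^{d-1}, σ)`, built from the orthogonal projections `proj_k` onto `H_k^d`. -/
def Tconv (d : ℕ) (proj : ℕ → Lp ℝ 2 (sphMeasure d) → Lp ℝ 2 (sphMeasure d)) (n : ℕ)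
    (f : Lp ℝ 2 (sphMeasure d)) : Lp ℝ 2 (sphMeasure d) :=
  ∑ j ∈ Finset.range (d - 1),
    ((-1 : ℝ) ^ j * ((d - 2).choose j : ℝ) * (cCoef d n / cCoef d (n + 2 * j))) •
      proj (n + 2 * j) f


/-- Evaluation of a polynomial at a point of Euclidean space. -/
def pev {d : ℕ} (P : MvPolynomial (Fin d) ℝ) (x : EuclideanSpace ℝ (Fin d)) : ℝ :=
  MvPolynomial.eval (fun i => x i) P

section SphereIBP

variable {d : ℕ}

@[simp] lemma pev_add (P Q : MvPolynomial (Fin d) ℝ) (x : EuclideanSpace ℝ (Fin d)) :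
    pev (P + Q) x = pev P x + pev Q x := by simp [pev]

@[simp] lemma pev_mul (P Q : MvPolynomial (Fin d) ℝ) (x : EuclideanSpace ℝ (Fin d)) :
    pev (P * Q) x = pev P x * pev Q x := by simp [pev]

@[simp] lemma pev_C (a : ℝ) (x : EuclideanSpace ℝ (Fin d)) :
    pev (MvPolynomial.C a) x = a := by simp [pev]

@[simp] lemma pev_X (i : Fin d) (x : EuclideanSpace ℝ (Fin d)) :
    pev (MvPolynomial.X i) x = x i := by simp [pev]

@[simp] lemma pev_sum {ι : Type*} (s : Finset ι) (P : ι → MvPolynomial (Fin d) ℝ)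
    (x : EuclideanSpace ℝ (Fin d)) : pev (∑ i ∈ s, P i) x = ∑ i ∈ s, pev (P i) x := by
  simp [pev, map_sum]

lemma continuous_pev (P : MvPolynomial (Fin d) ℝ) : Continuous (pev P) := by
  induction P using MvPolynomial.induction_on with
  | C a =>
    have : pev (MvPolynomial.C a : MvPolynomial (Fin d) ℝ) = fun _ => a := by ext; simp
    rw [this]; exact continuous_const
  | add p q hp hq =>
    have : pev (p + q) = fun x => pev p x + pev q x := by ext; simp
    rw [this]; exact hp.add hq
  | mul_X p i hp =>
    have : pev (p * MvPolynomial.X i) = fun x => pev p x * x i := by ext; simp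
    rw [this]; exact hp.mul (by fun_prop)

lemma pev_smul {P : MvPolynomial (Fin d) ℝ} {m : ℕ} (hP : P.IsHomogeneous m) (r : ℝ)
    (x : EuclideanSpace ℝ (Fin d)) : pev P (r • x) = r ^ m * pev P x := by
  simp only [pev, MvPolynomial.eval_eq, Finset.mul_sum]
  refine Finset.sum_congr rfl fun s hs => ?_
  have hs' : ∑ i, s i = m := by
    have h := hP (MvPolynomial.mem_support_iff.1 hs)
    rwa [Finsupp.weight_apply, Finsupp.sum_fintype _ _ (by simp), 
      Finset.sum_congr rfl (fun i _ => by simp : ∀ i ∈ Finset.univ, s i • (1 : Fin d → ℕ) i = s i)]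
      at h
  have : ∏ i ∈ s.support, (r • x) i ^ s i = r ^ m * ∏ i ∈ s.support, x i ^ s i := by
    rw [← hs', ← Finset.prod_pow_eq_pow_sum, ← Finset.prod_subset (Finset.subset_univ s.support),
      ← Finset.prod_mul_distrib]
    · exact Finset.prod_congr rfl fun i _ => by simp [mul_pow]
    · intro i _ hi; simp [Finsupp.notMem_support_iff.1 hi]
  rw [this]; ring

lemma hasLineDerivAt_pev (P : MvPolynomial (Fin d) ℝ) (i : Fin d)
    (x : EuclideanSpace ℝ (Fin d)) :
    HasLineDerivAt ℝ (pev P) (pev (MvPolynomial.pderiv i P) x) x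
      (EuclideanSpace.single i (1 : ℝ)) := by
  unfold HasLineDerivAt
  induction P using MvPolynomial.induction_on with
  | C a => simpa [pev] using hasDerivAt_const (0 : ℝ) a
  | add p q hp hq => simpa only [map_add, pev_add] using! hp.add hq
  | mul_X p j hp =>
    have hX : HasDerivAt (fun t : ℝ => (x + t • EuclideanSpace.single i (1 : ℝ)) j)
        (pev (MvPolynomial.pderiv i (MvPolynomial.X j)) x) 0 := by
      by_cases hij : j = i
      · subst hij
        simpa [pev] using (hasDerivAt_id (0 : ℝ)).const_add (x j)
      · have : i ≠ j := fun h => hij h.symm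
        simpa [MvPolynomial.pderiv_X_of_ne hij, EuclideanSpace.single, hij, pev, this]
          using hasDerivAt_const (0 : ℝ) (x j)
    have h := hp.mul hX
    simp only [zero_smul, add_zero] at h
    have e : pev (MvPolynomial.pderiv i (p * MvPolynomial.X j)) x =
        pev (MvPolynomial.pderiv i p) x * x j +
          pev p x * pev (MvPolynomial.pderiv i (MvPolynomial.X j)) x := by
      rw [Derivation.leibniz]; simp only [smul_eq_mul, pev_add, pev_mul, pev_X]; ring
    rw [e]
    exact h.congr_of_eventuallyEq (Filter.Eventually.of_forall fun t => by simp)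

lemma exists_pev_le (P : MvPolynomial (Fin d) ℝ) :
    ∃ C a : ℝ, 0 ≤ C ∧ 0 ≤ a ∧ ∀ x, |pev P x| ≤ C * Real.exp (a * ‖x‖) := by
  induction P using MvPolynomial.induction_on with
  | C b => exact ⟨|b|, 0, abs_nonneg b, le_rfl, fun x => by simp⟩
  | add p q hp hq =>
    obtain ⟨C, a, hC, ha, h⟩ := hp
    obtain ⟨C', a', hC', ha', h'⟩ := hq
    refine ⟨C + C', a + a', by positivity, by positivity, fun x => ?_⟩
    have e1 : Real.exp (a * ‖x‖) ≤ Real.exp ((a + a') * ‖x‖) := by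
      gcongr; linarith
    have e2 : Real.exp (a' * ‖x‖) ≤ Real.exp ((a + a') * ‖x‖) := by
      gcongr; linarith
    calc |pev (p + q) x| ≤ |pev p x| + |pev q x| := by simpa using abs_add_le _ _
      _ ≤ C * Real.exp (a * ‖x‖) + C' * Real.exp (a' * ‖x‖) := add_le_add (h x) (h' x)
      _ ≤ C * Real.exp ((a + a') * ‖x‖) + C' * Real.exp ((a + a') * ‖x‖) := by gcongr
      _ = _ := by ring
  | mul_X p i hp =>
    obtain ⟨C, a, hC, ha, h⟩ := hp
    refine ⟨C, a + 1, hC, by positivity, fun x => ?_⟩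
    have h1 : |x i| ≤ Real.exp ‖x‖ := by
      calc |x i| ≤ ‖x‖ := by simpa using EuclideanSpace.norm_eq x ▸ PiLp.norm_apply_le x i
        _ ≤ ‖x‖ + 1 := by linarith
        _ ≤ _ := Real.add_one_le_exp _
    calc |pev (p * MvPolynomial.X i) x| = |pev p x| * |x i| := by simp [abs_mul]
      _ ≤ (C * Real.exp (a * ‖x‖)) * Real.exp ‖x‖ := by gcongr; exact h x
      _ = _ := by rw [add_mul, one_mul, Real.exp_add]; ring

lemma integrable_pev_gaussian (P : MvPolynomial (Fin d) ℝ) :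
    Integrable (fun x : EuclideanSpace ℝ (Fin d) => pev P x * Real.exp (-‖x‖ ^ 2)) := by
  obtain ⟨C, a, hC, ha, h⟩ := exists_pev_le P
  have hg : Integrable (fun x : EuclideanSpace ℝ (Fin d) => Real.exp (-(1 / 2) * ‖x‖ ^ 2)) := by
    have := (GaussianFourier.integrable_cexp_neg_mul_sq_norm_add
      (V := EuclideanSpace ℝ (Fin d)) (b := 1 / 2) (by norm_num) 0 0).norm
    refine this.congr (Filter.Eventually.of_forall fun x => ?_)
    simp only [Complex.norm_exp]
    congr 1
    simp [← Complex.ofReal_pow]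
  refine (hg.const_mul (C * Real.exp (a ^ 2 / 2))).mono' ?_ (Filter.Eventually.of_forall fun x => ?_)
  · exact ((continuous_pev P).mul (by fun_prop)).aestronglyMeasurable
  · rw [Real.norm_eq_abs, abs_mul, abs_of_pos (Real.exp_pos _)]
    calc |pev P x| * Real.exp (-‖x‖ ^ 2)
        ≤ C * Real.exp (a * ‖x‖) * Real.exp (-‖x‖ ^ 2) := by gcongr; exact h x
      _ = C * Real.exp (a * ‖x‖ + -‖x‖ ^ 2) := by rw [Real.exp_add]; ring
      _ ≤ C * Real.exp (a ^ 2 / 2 + -(1 / 2) * ‖x‖ ^ 2) := by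
          have : a * ‖x‖ + -‖x‖ ^ 2 ≤ a ^ 2 / 2 + -(1 / 2) * ‖x‖ ^ 2 := by
            nlinarith [sq_nonneg (a - ‖x‖)]
          exact mul_le_mul_of_nonneg_left (Real.exp_le_exp.2 this) hC
      _ = _ := by rw [Real.exp_add]; ring

lemma hasLineDerivAt_gaussian (i : Fin d) (x : EuclideanSpace ℝ (Fin d)) :
    HasLineDerivAt ℝ (fun y : EuclideanSpace ℝ (Fin d) => Real.exp (-‖y‖ ^ 2))
      (-2 * x i * Real.exp (-‖x‖ ^ 2)) x (EuclideanSpace.single i (1 : ℝ)) := by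
  have h := ((hasStrictFDerivAt_norm_sq x).hasFDerivAt.neg.exp).hasLineDerivAt
    (EuclideanSpace.single i (1 : ℝ))
  convert! h using 1
  have : inner ℝ x (EuclideanSpace.single i (1 : ℝ)) = x i := by
    simp [EuclideanSpace.inner_single_right]
  simp [this]
  ring

lemma gaussian_ibp (P : MvPolynomial (Fin d) ℝ) (i : Fin d) :
    2 * ∫ x : EuclideanSpace ℝ (Fin d), pev (MvPolynomial.X i * P) x * Real.exp (-‖x‖ ^ 2) =
      ∫ x : EuclideanSpace ℝ (Fin d), pev (MvPolynomial.pderiv i P) x * Real.exp (-‖x‖ ^ 2) := by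
  have h := integral_bilinear_hasLineDerivAt_right_eq_neg_left_of_integrable
    (μ := (volume : Measure (EuclideanSpace ℝ (Fin d)))) (B := ContinuousLinearMap.mul ℝ ℝ)
    (f := pev P) (f' := fun x => pev (MvPolynomial.pderiv i P) x)
    (g := fun y => Real.exp (-‖y‖ ^ 2)) (g' := fun x => -2 * x i * Real.exp (-‖x‖ ^ 2))
    (v := EuclideanSpace.single i (1 : ℝ))
    (integrable_pev_gaussian _)
    (by
      refine ((integrable_pev_gaussian (MvPolynomial.X i * P)).const_mul (-2)).congr
        (Filter.Eventually.of_forall fun x => ?_)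
      simp; ring)
    (integrable_pev_gaussian _)
    (fun x _ => hasLineDerivAt_pev P i x) (fun x _ => hasLineDerivAt_gaussian i x)
  simp only [ContinuousLinearMap.mul_apply'] at h
  have h2 : ∫ x : EuclideanSpace ℝ (Fin d), pev P x * (-2 * x i * Real.exp (-‖x‖ ^ 2)) =
      -(2 * ∫ x : EuclideanSpace ℝ (Fin d),
        pev (MvPolynomial.X i * P) x * Real.exp (-‖x‖ ^ 2)) := by
    rw [← integral_const_mul, ← integral_neg]
    congr 1; ext x; simp; ring
  rw [h2] at h
  linarith

instance isFiniteMeasure_sphMeasure (d : ℕ) : IsFiniteMeasure (sphMeasure d) := by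
  unfold sphMeasure; infer_instance

/-- The integral over the sphere of a polynomial. -/
def sphInt (P : MvPolynomial (Fin d) ℝ) : ℝ :=
  ∫ x : Sph d, pev P (x : EuclideanSpace ℝ (Fin d)) ∂(sphMeasure d)

lemma gaussian_polar [NeZero d] {P : MvPolynomial (Fin d) ℝ} {m : ℕ} (hP : P.IsHomogeneous m) :
    ∫ x : EuclideanSpace ℝ (Fin d), pev P x * Real.exp (-‖x‖ ^ 2) =
      sphInt P * (1 / 2 * Real.Gamma (((m + d : ℕ) : ℝ) / 2)) := by
  have hd1 : 1 ≤ d := NeZero.one_le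
  set F : EuclideanSpace ℝ (Fin d) → ℝ := fun x => pev P x * Real.exp (-‖x‖ ^ 2) with hF
  have hr : ∫ r : Set.Ioi (0 : ℝ), (r : ℝ) ^ m * Real.exp (-(r : ℝ) ^ 2)
      ∂(Measure.volumeIoiPow (d - 1)) = 1 / 2 * Real.Gamma (((m + d : ℕ) : ℝ) / 2) := by
    have h0 := integral_rpow_mul_exp_neg_rpow (p := 2) (q := ((m + d - 1 : ℕ) : ℝ)) (by norm_num)
      (by have : (0 : ℝ) ≤ ((m + d - 1 : ℕ) : ℝ) := by positivity
          linarith)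
    have h1 : (((m + d - 1 : ℕ) : ℝ) + 1) = ((m + d : ℕ) : ℝ) := by
      have : m + d - 1 + 1 = m + d := by omega
      exact_mod_cast this
    rw [h1] at h0
    rw [← h0]
    simp only [Measure.volumeIoiPow, ENNReal.ofReal]
    rw [integral_withDensity_eq_integral_smul,
      integral_subtype_comap measurableSet_Ioi
        fun a : ℝ ↦ Real.toNNReal (a ^ (d - 1)) • (a ^ m * Real.exp (-a ^ 2)),
      setIntegral_congr_fun measurableSet_Ioi fun x hx ↦ ?_]
    · have hx0 : (0 : ℝ) < x := hx
      simp only [NNReal.smul_def, Real.coe_toNNReal _ (pow_nonneg hx0.le _), smul_eq_mul]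
      rw [Real.rpow_natCast, ← mul_assoc, ← pow_add]
      congr 2
      · omega
      · norm_num
    · exact (measurable_subtype_coe.pow_const _).real_toNNReal
  calc ∫ x, F x = ∫ x : ({(0)}ᶜ : Set (EuclideanSpace ℝ (Fin d))), F x.1
        ∂(volume.comap (Subtype.val)) := by
        rw [integral_subtype_comap (measurableSet_singleton _).compl F,
          restrict_compl_singleton]
    _ = ∫ x : Sph d × Set.Ioi (0 : ℝ), pev P (x.1 : EuclideanSpace ℝ (Fin d)) *
          ((x.2 : ℝ) ^ m * Real.exp (-(x.2 : ℝ) ^ 2)) ∂((sphMeasure d).prod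
          (Measure.volumeIoiPow (d - 1))) := by
        have := (volume : Measure (EuclideanSpace ℝ (Fin d))).measurePreserving_homeomorphUnitSphereProd
        rw [finrank_euclideanSpace_fin] at this
        rw [sphMeasure, ← this.integral_comp (Homeomorph.measurableEmbedding _)]
        refine integral_congr_ae (Filter.Eventually.of_forall fun x => ?_)
        have hx : ‖x.1‖ ≠ 0 := norm_ne_zero_iff.2 x.2
        simp only [homeomorphUnitSphereProd_apply_snd_coe, homeomorphUnitSphereProd_apply_fst_coe,
          hF]
        rw [pev_smul hP, inv_pow]
        have : ‖x.1‖ ^ m ≠ 0 := pow_ne_zero _ hx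
        field_simp
    _ = _ := by
        rw [integral_prod_mul (fun x : Sph d => pev P (x : EuclideanSpace ℝ (Fin d)))
          (fun r : Set.Ioi (0 : ℝ) => (r : ℝ) ^ m * Real.exp (-(r : ℝ) ^ 2)), hr, sphInt]

/-- Integration by parts on the sphere for homogeneous polynomials. -/
lemma sphInt_X_mul [NeZero d] {h : MvPolynomial (Fin d) ℝ} {k : ℕ} (hh : h.IsHomogeneous k)
    (i : Fin d) :
    ((k : ℝ) + d - 1) * sphInt (MvPolynomial.X i * h) = sphInt (MvPolynomial.pderiv i h) := by
  have hd1 : 1 ≤ d := NeZero.one_le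
  have h1 := gaussian_polar ((MvPolynomial.isHomogeneous_X ℝ i).mul hh)
  rcases Nat.eq_zero_or_pos k with rfl | hk
  · have h0 : MvPolynomial.pderiv i h = 0 := by
      rw [← MvPolynomial.totalDegree_zero_iff_isHomogeneous,
        MvPolynomial.totalDegree_eq_zero_iff_eq_C] at hh
      rw [hh, MvPolynomial.pderiv_C]
    have h3 := gaussian_ibp h i
    rw [h1, h0] at h3
    have hG : 0 < Real.Gamma (((1 + 0 + d : ℕ) : ℝ) / 2) :=
      Real.Gamma_pos_of_pos (by positivity)
    have : sphInt (MvPolynomial.X i * h) = 0 := by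
      simp only [pev, map_zero, zero_mul, integral_zero] at h3
      rcases mul_eq_zero.1 h3 with h | h
      · norm_num at h
      · rcases mul_eq_zero.1 h with h | h
        · exact h
        · exact absurd h (by positivity)
    rw [this, h0]
    simp [sphInt, pev]
  have h2 := gaussian_polar (hh.pderiv (i := i))
  have h3 := gaussian_ibp h i
  rw [h1, h2] at h3
  have hpos : (0 : ℝ) < ((k - 1 + d : ℕ) : ℝ) / 2 := by
    have : 0 < k - 1 + d := by omega
    positivity
  have hG : Real.Gamma (((1 + k + d : ℕ) : ℝ) / 2) =
      ((k - 1 + d : ℕ) : ℝ) / 2 * Real.Gamma (((k - 1 + d : ℕ) : ℝ) / 2) := by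
    rw [← Real.Gamma_add_one hpos.ne']
    congr 1
    have : ((1 + k + d : ℕ) : ℝ) = ((k - 1 + d : ℕ) : ℝ) + 2 := by
      have : 1 + k + d = (k - 1 + d) + 2 := by omega
      exact_mod_cast this
    rw [this]; ring
  rw [hG] at h3
  have hGpos := Real.Gamma_pos_of_pos hpos
  have hc : ((k - 1 + d : ℕ) : ℝ) = k + d - 1 := by
    have : k - 1 + d + 1 = k + d := by omega
    have : ((k - 1 + d : ℕ) : ℝ) + 1 = k + d := by exact_mod_cast this
    linarith
  rw [← hc]
  have : (((k - 1 + d : ℕ) : ℝ) * sphInt (MvPolynomial.X i * h) - sphInt (MvPolynomial.pderiv i h)) *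
      Real.Gamma (((k - 1 + d : ℕ) : ℝ) / 2) = 0 := by linarith
  rcases mul_eq_zero.1 this with h | h
  · linarith
  · exact absurd h hGpos.ne'

end SphereIBP

/-- Homogeneous Gegenbauer polynomials, evaluated in a commutative algebra. -/
def geg (lam : ℝ) {A : Type*} [CommRing A] [Algebra ℝ A] (L R : A) : ℕ → A
  | 0 => 1
  | 1 => (2 * lam) • L
  | (k + 2) => ((k : ℝ) + 2)⁻¹ • ((2 * ((k : ℝ) + 1 + lam)) • (L * geg lam L R (k + 1)) -
      ((k : ℝ) + 2 * lam) • (R * geg lam L R k))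

section GegenbauerAlgebra

lemma geg_rec (lam : ℝ) {A : Type*} [CommRing A] [Algebra ℝ A] (L R : A) (k : ℕ) :
    ((k : ℝ) + 2) • geg lam L R (k + 2) = (2 * ((k : ℝ) + 1 + lam)) • (L * geg lam L R (k + 1)) -
      ((k : ℝ) + 2 * lam) • (R * geg lam L R k) := by
  rw [geg, smul_inv_smul₀ (by positivity)]

lemma map_geg (lam : ℝ) {A B : Type*} [CommRing A] [Algebra ℝ A] [CommRing B] [Algebra ℝ B]
    (φ : A →ₐ[ℝ] B) (L R : A) (k : ℕ) : φ (geg lam L R k) = geg lam (φ L) (φ R) k := by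
  induction k using Nat.twoStepInduction with
  | zero => simp [geg]
  | one => simp [geg]
  | more k h1 h2 => simp [geg, h1, h2]

variable {d : ℕ}

open MvPolynomial in
/-- The Laplacian of a polynomial. -/
def lap (P : MvPolynomial (Fin d) ℝ) : MvPolynomial (Fin d) ℝ := ∑ i, pderiv i (pderiv i P)

/-- A polynomial that is harmonic and homogeneous of degree `k`. -/
def Harm (k : ℕ) (P : MvPolynomial (Fin d) ℝ) : Prop := P.IsHomogeneous k ∧ lap P = 0

open MvPolynomial in
/-- The directional derivative of a polynomial. -/
def dirD (x : EuclideanSpace ℝ (Fin d)) :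
    Derivation ℝ (MvPolynomial (Fin d) ℝ) (MvPolynomial (Fin d) ℝ) := ∑ i, x i • pderiv i

open MvPolynomial in
lemma dirD_apply (x : EuclideanSpace ℝ (Fin d)) (P : MvPolynomial (Fin d) ℝ) :
    dirD x P = ∑ i, x i • pderiv i P := by
  have : ∀ s : Finset (Fin d), (∑ i ∈ s, x i • pderiv i :
      Derivation ℝ (MvPolynomial (Fin d) ℝ) (MvPolynomial (Fin d) ℝ)) P =
      ∑ i ∈ s, x i • pderiv i P := by
    intro s
    induction s using Finset.induction_on with
    | empty => simp
    | insert a s ha ih => simp [Finset.sum_insert ha, ih]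
  exact this _

open MvPolynomial in
/-- The linear form `⟨x, ·⟩`. -/
def linF (x : EuclideanSpace ℝ (Fin d)) : MvPolynomial (Fin d) ℝ := ∑ i, x i • X i

open MvPolynomial in
/-- The polynomial `‖·‖²`. -/
def normSqP (d : ℕ) : MvPolynomial (Fin d) ℝ := ∑ i, X i ^ 2

open MvPolynomial

lemma pderiv_linF (x : EuclideanSpace ℝ (Fin d)) (i : Fin d) :
    pderiv i (linF x) = C (x i) := by
  simp [linF, pderiv_X, Pi.single_apply, smul_eq_C_mul]

lemma pderiv_normSqP (i : Fin d) : pderiv i (normSqP d) = (2 : ℝ) • X i := by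
  simp [normSqP, pderiv_X, Pi.single_apply, Derivation.leibniz_pow, smul_eq_C_mul, map_ofNat]

lemma lap_add (P Q : MvPolynomial (Fin d) ℝ) : lap (P + Q) = lap P + lap Q := by
  simp [lap, Finset.sum_add_distrib]

lemma lap_sub (P Q : MvPolynomial (Fin d) ℝ) : lap (P - Q) = lap P - lap Q := by
  simp [lap]

lemma lap_smul (a : ℝ) (P : MvPolynomial (Fin d) ℝ) : lap (a • P) = a • lap P := by
  simp [lap, Finset.smul_sum]

lemma lap_linF_mul (x : EuclideanSpace ℝ (Fin d)) (P : MvPolynomial (Fin d) ℝ) :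
    lap (linF x * P) = linF x * lap P + (2 : ℝ) • dirD x P := by
  simp only [lap, dirD_apply, Derivation.leibniz, pderiv_linF, map_add, smul_eq_mul, pderiv_C,
    Finset.mul_sum, Finset.smul_sum, ← Finset.sum_add_distrib]
  refine Finset.sum_congr rfl fun i _ => ?_
  simp only [smul_eq_C_mul, map_ofNat]; ring

lemma lap_normSqP_mul {k : ℕ} {P : MvPolynomial (Fin d) ℝ} (hP : P.IsHomogeneous k) :
    lap (normSqP d * P) = normSqP d * lap P + (2 * (d : ℝ) + 4 * k) • P := by
  have hE := hP.sum_X_mul_pderiv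
  have : (2 * (d : ℝ) + 4 * k) • P = ∑ i : Fin d, ((2 : ℝ) • P + (4 : ℝ) • (X i * pderiv i P)) := by
    rw [Finset.sum_add_distrib, ← Finset.smul_sum, ← Finset.smul_sum, hE]
    simp only [smul_eq_C_mul, map_ofNat, map_add, map_mul, map_natCast, nsmul_eq_mul,
      Finset.sum_const, Finset.card_univ, Fintype.card_fin]; ring
  rw [this]
  simp only [lap, Derivation.leibniz, pderiv_normSqP, map_add, smul_eq_mul, pderiv_X_self,
    Finset.mul_sum, ← Finset.sum_add_distrib, Derivation.map_smul]
  refine Finset.sum_congr rfl fun i _ => ?_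
  simp only [smul_eq_C_mul, map_ofNat]; ring

lemma dirD_linF {x : EuclideanSpace ℝ (Fin d)} (hx : ‖x‖ = 1) : dirD x (linF x) = 1 := by
  have : ∑ i, x i * x i = 1 := by
    have h := EuclideanSpace.real_norm_sq_eq x
    rw [hx] at h; simpa [pow_two] using h.symm
  rw [dirD_apply]
  simp only [pderiv_linF, smul_eq_C_mul, ← map_mul, ← map_sum, this, map_one]

lemma dirD_normSqP (x : EuclideanSpace ℝ (Fin d)) : dirD x (normSqP d) = (2 : ℝ) • linF x := by
  rw [dirD_apply, linF, Finset.smul_sum]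
  refine Finset.sum_congr rfl fun i _ => ?_
  rw [pderiv_normSqP, smul_comm]

lemma isHomogeneous_linF (x : EuclideanSpace ℝ (Fin d)) : (linF x).IsHomogeneous 1 := by
  refine IsHomogeneous.sum _ _ _ fun i _ => ?_
  rw [smul_eq_C_mul]; exact (isHomogeneous_X ℝ i).C_mul _

lemma isHomogeneous_normSqP : (normSqP d).IsHomogeneous 2 :=
  IsHomogeneous.sum _ _ _ fun i _ => isHomogeneous_X_pow i 2

lemma isHomogeneous_geg (lam : ℝ) (x : EuclideanSpace ℝ (Fin d)) (k : ℕ) :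
    (geg lam (linF x) (normSqP d) k).IsHomogeneous k := by
  induction k using Nat.twoStepInduction with
  | zero => exact isHomogeneous_one _ _
  | one =>
    rw [geg, smul_eq_C_mul]; exact (isHomogeneous_linF x).C_mul _
  | more k h1 h2 =>
    simp only [geg, smul_eq_C_mul]
    refine (IsHomogeneous.sub ?_ ?_).C_mul _
    · have := ((isHomogeneous_linF x).mul h2).C_mul (2 * ((k : ℝ) + 1 + lam))
      rwa [show 1 + (k + 1) = k + 2 by ring] at this
    · have := (isHomogeneous_normSqP.mul h1).C_mul ((k : ℝ) + 2 * lam)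
      rwa [show 2 + k = k + 2 by ring] at this

lemma dirD_geg (lam : ℝ) {x : EuclideanSpace ℝ (Fin d)} (hx : ‖x‖ = 1) (k : ℕ) :
    dirD x (geg lam (linF x) (normSqP d) (k + 1)) =
      ((k : ℝ) + 2 * lam) • geg lam (linF x) (normSqP d) k := by
  induction k using Nat.twoStepInduction with
  | zero => simp [geg, dirD_linF hx]
  | one =>
    have e1 := geg_rec lam (linF x) (normSqP d) 0
    have e3 := congrArg (dirD x) e1
    have h1 : dirD x (geg lam (linF x) (normSqP d) 1) = (2 * lam) • 1 := by
      simp [geg, dirD_linF hx]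
    have h0 : geg lam (linF x) (normSqP d) 0 = 1 := rfl
    have e2 : geg lam (linF x) (normSqP d) 1 = (2 * lam) • linF x := rfl
    simp only [zero_add] at e3 e2 h1 ⊢
    simp only [map_sub, Derivation.map_smul, Derivation.leibniz, dirD_linF hx, h0, h1,
      dirD_normSqP, smul_eq_mul, Derivation.map_one_eq_zero] at e3
    set G1 := geg lam (linF x) (normSqP d) 1
    have hC : IsUnit (C (2 : ℝ) : MvPolynomial (Fin d) ℝ) :=
      (IsUnit.mk0 _ (by norm_num)).map C
    apply hC.mul_left_cancel
    push_cast [smul_eq_C_mul, map_add, map_mul, map_sub, map_ofNat, map_natCast, map_one,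
      map_zero] at *
    linear_combination e3 - 2 * C lam * e2
  | more k h1 h2 =>
    have e1 := geg_rec lam (linF x) (normSqP d) (k + 1)
    have e2 := geg_rec lam (linF x) (normSqP d) k
    have e3 := congrArg (dirD x) e1
    simp only [map_sub, Derivation.map_smul, Derivation.leibniz, dirD_linF hx,
      dirD_normSqP, smul_eq_mul, h1, h2] at e3
    set G0 := geg lam (linF x) (normSqP d) k
    set G1 := geg lam (linF x) (normSqP d) (k + 1)
    set G2 := geg lam (linF x) (normSqP d) (k + 2)
    set G3 := geg lam (linF x) (normSqP d) (k + 1 + 2)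
    have h0 : ((k : ℝ) + 3) ≠ 0 := by positivity
    have hC : IsUnit (C ((k : ℝ) + 3) : MvPolynomial (Fin d) ℝ) := (IsUnit.mk0 _ h0).map C
    apply hC.mul_left_cancel
    push_cast [smul_eq_C_mul, map_add, map_mul, map_sub, map_ofNat, map_natCast, map_one] at *
    linear_combination e3 - ((k : MvPolynomial (Fin d) ℝ) + 1 + 2 * C lam) * e2

lemma lap_geg {lam : ℝ} (hlam : (d : ℝ) = 2 * lam + 2)
    {x : EuclideanSpace ℝ (Fin d)} (hx : ‖x‖ = 1) (k : ℕ) :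
    lap (geg lam (linF x) (normSqP d) k) = 0 := by
  induction k using Nat.twoStepInduction with
  | zero => simp [geg, lap]
  | one => simp [geg, lap, pderiv_linF]
  | more k h1 h2 =>
    rw [geg, lap_smul, lap_sub, lap_smul, lap_smul, lap_linF_mul,
      lap_normSqP_mul (isHomogeneous_geg lam x k), h1, h2, dirD_geg lam hx, hlam]
    simp only [mul_zero, zero_add, smul_smul, ← sub_smul]
    convert zero_smul ℝ _
    ring

lemma harm_geg {lam : ℝ} (hlam : (d : ℝ) = 2 * lam + 2)
    {x : EuclideanSpace ℝ (Fin d)} (hx : ‖x‖ = 1) (k : ℕ) :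
    Harm k (geg lam (linF x) (normSqP d) k) :=
  ⟨isHomogeneous_geg lam x k, lap_geg hlam hx k⟩

lemma pev_geg (lam : ℝ) (x y : EuclideanSpace ℝ (Fin d)) (hy : ‖y‖ = 1) (k : ℕ) :
    pev (geg lam (linF x) (normSqP d) k) y = geg lam (inner ℝ x y) (1 : ℝ) k := by
  have h := map_geg lam (MvPolynomial.aeval (R := ℝ) (fun i => y i)) (linF x) (normSqP d) k
  have h1 : MvPolynomial.aeval (R := ℝ) (fun i => y i) (linF x) = inner ℝ x y := by
    simp [linF, PiLp.inner_apply, mul_comm]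
  have h2 : MvPolynomial.aeval (R := ℝ) (fun i => y i) (normSqP d) = 1 := by
    have h := EuclideanSpace.real_norm_sq_eq y
    rw [hy] at h; simpa [normSqP] using h.symm
  rw [h1, h2] at h
  rw [← h, pev, MvPolynomial.aeval_eq_eval]

end GegenbauerAlgebra

section SphereHarmonics

variable {d : ℕ}

open MvPolynomial

lemma integrable_pev (P : MvPolynomial (Fin d) ℝ) :
    Integrable (fun x : Sph d => pev P (x : EuclideanSpace ℝ (Fin d))) (sphMeasure d) :=
  ((continuous_pev P).comp continuous_subtype_val).integrable_of_hasCompactSupport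
    (HasCompactSupport.of_compactSpace _)

lemma sphInt_add (P Q : MvPolynomial (Fin d) ℝ) : sphInt (P + Q) = sphInt P + sphInt Q := by
  simp only [sphInt, pev_add]
  exact integral_add (integrable_pev P) (integrable_pev Q)

lemma sphInt_smul (a : ℝ) (P : MvPolynomial (Fin d) ℝ) : sphInt (a • P) = a * sphInt P := by
  simp only [sphInt, smul_eq_C_mul, pev_mul, pev_C]
  exact integral_const_mul _ _

lemma sphInt_sub (P Q : MvPolynomial (Fin d) ℝ) : sphInt (P - Q) = sphInt P - sphInt Q := by
  have h : P - Q = P + (-1 : ℝ) • Q := by rw [neg_one_smul]; ring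
  rw [h, sphInt_add, sphInt_smul]; ring

lemma sphInt_sum {ι : Type*} (s : Finset ι) (P : ι → MvPolynomial (Fin d) ℝ) :
    sphInt (∑ i ∈ s, P i) = ∑ i ∈ s, sphInt (P i) := by
  simp only [sphInt, pev_sum]
  exact integral_finsetSum _ fun i _ => integrable_pev (P i)

lemma sphInt_normSqP_mul (P : MvPolynomial (Fin d) ℝ) : sphInt (normSqP d * P) = sphInt P := by
  simp only [sphInt, pev_mul]
  congr 1; ext x
  have h := EuclideanSpace.real_norm_sq_eq (x : EuclideanSpace ℝ (Fin d))
  have hx : ‖(x : EuclideanSpace ℝ (Fin d))‖ = 1 := by simp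
  rw [hx] at h
  have : pev (normSqP d) (x : EuclideanSpace ℝ (Fin d)) = 1 := by
    simpa [normSqP, pev] using h.symm
  rw [this, one_mul]

lemma pderiv_comm (i j : Fin d) (P : MvPolynomial (Fin d) ℝ) :
    pderiv i (pderiv j P) = pderiv j (pderiv i P) := by
  have h : ⁅(pderiv i : Derivation ℝ (MvPolynomial (Fin d) ℝ) (MvPolynomial (Fin d) ℝ)),
      (pderiv j : Derivation ℝ (MvPolynomial (Fin d) ℝ) (MvPolynomial (Fin d) ℝ))⁆ = 0 := by
    refine derivation_ext fun k => ?_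
    simp [Derivation.commutator_apply, pderiv_X, Pi.single_apply, apply_ite]
  have h' := congrArg (fun D => D P) h
  simpa [Derivation.commutator_apply, sub_eq_zero] using h'

lemma Harm.dirD {k : ℕ} {P : MvPolynomial (Fin d) ℝ} (hP : Harm (k + 1) P)
    (x : EuclideanSpace ℝ (Fin d)) : Harm k (dirD x P) := by
  rw [dirD_apply]
  constructor
  · refine IsHomogeneous.sum _ _ _ fun i _ => ?_
    rw [smul_eq_C_mul]
    exact (hP.1.pderiv (i := i)).C_mul _
  · have h : ∀ i : Fin d, lap (pderiv i P) = 0 := by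
      intro i
      have : lap (pderiv i P) = pderiv i (lap P) := by
        simp only [lap, map_sum]
        refine Finset.sum_congr rfl fun j _ => ?_
        rw [pderiv_comm j i P, pderiv_comm j i]
      rw [this, hP.2, map_zero]
    have hs : ∀ s : Finset (Fin d), lap (∑ i ∈ s, x i • pderiv i P) = 0 := by
      intro s
      induction s using Finset.induction_on with
      | empty => simp [lap]
      | insert a s ha ih => rw [Finset.sum_insert ha, lap_add, ih, lap_smul, h, smul_zero, add_zero]
    exact hs _

lemma pev_dirD_self {k : ℕ} {P : MvPolynomial (Fin d) ℝ} (hP : P.IsHomogeneous k)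
    (x : EuclideanSpace ℝ (Fin d)) : pev (dirD x P) x = k * pev P x := by
  have hE := congrArg (fun Q => pev Q x) hP.sum_X_mul_pderiv
  simp only [pev_sum, pev_mul, pev_X, nsmul_eq_mul] at hE
  rw [dirD_apply]
  simp only [pev_sum, smul_eq_C_mul, pev_mul, pev_C, hE]
  simp [pev]

lemma sphInt_green [NeZero d] {n l : ℕ} {p q : MvPolynomial (Fin d) ℝ} (hp : p.IsHomogeneous n)
    (hq : Harm l q) :
    ((n : ℝ) + l + d - 2) * l * sphInt (p * q) = ∑ i, sphInt (pderiv i p * pderiv i q) := by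
  rcases Nat.eq_zero_or_pos l with rfl | hl
  · have : ∀ i, pderiv i q = 0 := by
      intro i
      have hh := hq.1
      rw [← totalDegree_zero_iff_isHomogeneous, totalDegree_eq_zero_iff_eq_C] at hh
      rw [hh, pderiv_C]
    simp [this, sphInt, pev]
  have h1 : ∀ i, ((n : ℝ) + l + d - 2) * sphInt (X i * (p * pderiv i q)) =
      sphInt (pderiv i p * pderiv i q) + sphInt (p * pderiv i (pderiv i q)) := by
    intro i
    have h := sphInt_X_mul (hp.mul (hq.1.pderiv (i := i))) i
    rw [Derivation.leibniz, smul_eq_mul, smul_eq_mul, sphInt_add] at h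
    have hc : ((n + (l - 1) : ℕ) : ℝ) = n + l - 1 := by
      push_cast [Nat.cast_sub hl]; ring
    rw [hc] at h
    rw [mul_comm (pderiv i p)]
    linarith
  have h2 : ∑ i, sphInt (X i * (p * pderiv i q)) = l * sphInt (p * q) := by
    rw [← sphInt_sum, ← sphInt_smul]
    congr 1
    have := hq.1.sum_X_mul_pderiv
    rw [smul_eq_C_mul, map_natCast, mul_left_comm, ← nsmul_eq_mul, ← this, Finset.mul_sum]
    exact Finset.sum_congr rfl fun i _ => by ring
  have h3 : ∑ i, sphInt (p * pderiv i (pderiv i q)) = 0 := by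
    rw [← sphInt_sum, ← Finset.mul_sum]
    have : ∑ i, pderiv i (pderiv i q) = 0 := hq.2
    rw [this]; simp [sphInt, pev]
  rw [mul_assoc, ← h2, Finset.mul_sum, Finset.sum_congr rfl fun i _ => h1 i,
    Finset.sum_add_distrib, h3, add_zero]

lemma sphInt_mul_eq_zero (hd : 3 ≤ d) {n l : ℕ} (hnl : n ≠ l) {p q : MvPolynomial (Fin d) ℝ}
    (hp : Harm n p) (hq : Harm l q) : sphInt (p * q) = 0 := by
  have : NeZero d := ⟨by omega⟩
  have h1 := sphInt_green hp.1 hq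
  have h2 := sphInt_green hq.1 hp
  have h3 : ∑ i, sphInt (pderiv i q * pderiv i p) = ∑ i, sphInt (pderiv i p * pderiv i q) :=
    Finset.sum_congr rfl fun i _ => by rw [mul_comm]
  rw [h3, ← h1, mul_comm q p] at h2
  have hd' : (3 : ℝ) ≤ d := by exact_mod_cast hd
  have h4 : ((n : ℝ) + l + d - 2) * ((n : ℝ) - l) * sphInt (p * q) = 0 := by linarith
  have h5 : (0 : ℝ) < (n : ℝ) + l + d - 2 := by
    have : (0 : ℝ) ≤ n := by positivity
    have : (0 : ℝ) ≤ l := by positivity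
    linarith
  have h6 : (n : ℝ) - l ≠ 0 := sub_ne_zero.2 (by exact_mod_cast hnl)
  exact (mul_eq_zero.1 h4).resolve_left (mul_ne_zero h5.ne' h6)

lemma sphInt_dirD [NeZero d] {k : ℕ} {P : MvPolynomial (Fin d) ℝ} (hP : P.IsHomogeneous k)
    (x : EuclideanSpace ℝ (Fin d)) :
    ((k : ℝ) + d - 1) * sphInt (linF x * P) = sphInt (dirD x P) := by
  rw [linF, dirD_apply, Finset.sum_mul, sphInt_sum, sphInt_sum, Finset.mul_sum]
  refine Finset.sum_congr rfl fun i _ => ?_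
  rw [smul_mul_assoc, sphInt_smul, sphInt_smul, ← sphInt_X_mul hP i]; ring

/-- The reproducing property of Gegenbauer polynomials. -/
lemma sphInt_geg_mul (hd : 3 ≤ d) {lam : ℝ} (hlam : (d : ℝ) = 2 * lam + 2)
    {x : EuclideanSpace ℝ (Fin d)} (hx : ‖x‖ = 1) {k : ℕ} {p : MvPolynomial (Fin d) ℝ}
    (hp : Harm k p) :
    ((k : ℝ) + lam) * sphInt (geg lam (linF x) (normSqP d) k * p) =
      lam * ((sphMeasure d).real Set.univ * pev p x) := by
  have : NeZero d := ⟨by omega⟩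
  have hd' : (3 : ℝ) ≤ d := by exact_mod_cast hd
  have hconst : ∀ q : MvPolynomial (Fin d) ℝ, Harm 0 q →
      sphInt q = (sphMeasure d).real Set.univ * pev q x := by
    intro q hq
    have hh := hq.1
    rw [← totalDegree_zero_iff_isHomogeneous, totalDegree_eq_zero_iff_eq_C] at hh
    rw [hh]; simp [sphInt]
  induction k generalizing p with
  | zero => simp [geg, hconst p hp]
  | succ k ih =>
    have hD := ih (hp.dirD x)
    rw [pev_dirD_self hp.1] at hD
    have h1 := sphInt_dirD ((isHomogeneous_geg lam x k).mul hp.1) x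
    rw [Derivation.leibniz, smul_eq_mul, smul_eq_mul, sphInt_add] at h1
    have h2 : sphInt (p * dirD x (geg lam (linF x) (normSqP d) k)) = 0 := by
      cases k with
      | zero => simp [geg, sphInt, pev]
      | succ k =>
        rw [dirD_geg lam hx, mul_smul_comm, sphInt_smul,
          sphInt_mul_eq_zero hd (by omega) hp (harm_geg hlam hx k), mul_zero]
    rw [h2] at h1
    have h3 : ((k : ℝ) + 1) * sphInt (geg lam (linF x) (normSqP d) (k + 1) * p) =
        2 * (k + lam) * sphInt (linF x * (geg lam (linF x) (normSqP d) k * p)) := by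
      cases k with
      | zero => simp [geg, sphInt_smul]
      | succ k =>
        have h := congrArg (fun Q => sphInt (Q * p)) (geg_rec lam (linF x) (normSqP d) k)
        simp only [smul_mul_assoc, sub_mul, sphInt_sub, sphInt_smul, mul_assoc] at h
        rw [sphInt_normSqP_mul, sphInt_mul_eq_zero hd (by omega) (harm_geg hlam hx k) hp] at h
        push_cast
        linarith
    push_cast at h1 h3 hD ⊢
    have hk : (0 : ℝ) < (k : ℝ) + 1 := by positivity
    have hkl : (0 : ℝ) < (k : ℝ) + 1 + lam := by linarith
    have h4 : (2 * ((k : ℝ) + 1 + lam)) * sphInt (linF x * (geg lam (linF x) (normSqP d) k * p)) =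
        sphInt (geg lam (linF x) (normSqP d) k * dirD x p) := by
      rw [hlam] at h1; linarith
    apply mul_left_cancel₀ hk.ne'
    linear_combination ((k : ℝ) + 1 + lam) * h3 + (k + lam) * h4 + hD

/-- The zonal polynomial of degree `k`. -/
def zon (lam : ℝ) (k : ℕ) (t : ℝ) : ℝ := ((k + lam) / lam) * geg lam t (1 : ℝ) k

end SphereHarmonics

section Projection

variable {d : ℕ}

open MvPolynomial

lemma memLp_pev (P : MvPolynomial (Fin d) ℝ) (q : ℝ≥0∞) :
    MemLp (fun x : Sph d => pev P (x : EuclideanSpace ℝ (Fin d))) q (sphMeasure d) :=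
  ((continuous_pev P).comp continuous_subtype_val).memLp_of_hasCompactSupport
    (HasCompactSupport.of_compactSpace _)

/-- The class in `L²` of the restriction of a polynomial to the sphere. -/
def polyLp (P : MvPolynomial (Fin d) ℝ) : Lp ℝ 2 (sphMeasure d) := (memLp_pev P 2).toLp _

lemma coeFn_polyLp (P : MvPolynomial (Fin d) ℝ) :
    polyLp P =ᵐ[sphMeasure d] fun x : Sph d => pev P (x : EuclideanSpace ℝ (Fin d)) :=
  MemLp.coeFn_toLp _

lemma polyLp_mem {k : ℕ} {P : MvPolynomial (Fin d) ℝ} (hP : Harm k P) :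
    polyLp P ∈ Hspace d k :=
  Submodule.subset_span ⟨_, ⟨P, hP.1, hP.2, fun _ => rfl⟩, coeFn_polyLp P⟩

lemma exists_polyLp_eq {k : ℕ} {f : Lp ℝ 2 (sphMeasure d)} (hf : f ∈ Hspace d k) :
    ∃ P, Harm k P ∧ f = polyLp P := by
  induction hf using Submodule.span_induction with
  | mem f hf =>
    obtain ⟨Y, ⟨P, h1, h2, h3⟩, hY⟩ := hf
    refine ⟨P, ⟨h1, h2⟩, Lp.ext ?_⟩
    filter_upwards [hY, coeFn_polyLp P] with x hx hx'
    rw [hx, hx', h3]; rfl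
  | zero =>
    refine ⟨0, ⟨isHomogeneous_zero _ _ _, by simp [lap]⟩, Lp.ext ?_⟩
    filter_upwards [Lp.coeFn_zero ℝ 2 (sphMeasure d), coeFn_polyLp (0 : MvPolynomial (Fin d) ℝ)]
      with x hx hx'
    rw [hx, hx']; simp [pev]
  | add f g _ _ hf hg =>
    obtain ⟨P, hP, rfl⟩ := hf
    obtain ⟨Q, hQ, rfl⟩ := hg
    refine ⟨P + Q, ⟨hP.1.add hQ.1, by rw [lap_add, hP.2, hQ.2, add_zero]⟩, Lp.ext ?_⟩
    filter_upwards [Lp.coeFn_add (polyLp P) (polyLp Q), coeFn_polyLp P, coeFn_polyLp Q,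
      coeFn_polyLp (P + Q)] with x h1 h2 h3 h4
    rw [h1, h4, Pi.add_apply, h2, h3, pev_add]
  | smul a f _ hf =>
    obtain ⟨P, hP, rfl⟩ := hf
    refine ⟨a • P, ⟨by rw [smul_eq_C_mul]; exact hP.1.C_mul _, by rw [lap_smul, hP.2, smul_zero]⟩,
      Lp.ext ?_⟩
    filter_upwards [Lp.coeFn_smul a (polyLp P), coeFn_polyLp P, coeFn_polyLp (a • P)]
      with x h1 h2 h3
    rw [h1, h3, Pi.smul_apply, h2, smul_eq_C_mul, pev_mul, pev_C, smul_eq_mul]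

lemma inner_polyLp (f : Lp ℝ 2 (sphMeasure d)) (P : MvPolynomial (Fin d) ℝ) :
    inner ℝ f (polyLp P) = ∫ y, pev P (y : EuclideanSpace ℝ (Fin d)) * f y ∂(sphMeasure d) := by
  rw [L2.inner_def]
  refine integral_congr_ae ?_
  filter_upwards [coeFn_polyLp P] with y hy
  rw [hy]; simp

lemma sphMeasure_real_univ_pos (hd : 3 ≤ d) : 0 < (sphMeasure d).real Set.univ := by
  have : NeZero d := ⟨by omega⟩
  have h : (volume : Measure (EuclideanSpace ℝ (Fin d))).toSphere ≠ 0 :=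
    Measure.toSphere_ne_zero _
  rw [Measure.real, ENNReal.toReal_pos_iff]
  refine ⟨?_, measure_lt_top _ _⟩
  rw [pos_iff_ne_zero, Ne, Measure.measure_univ_eq_zero]
  exact h

lemma abs_inner_le_one (x y : Sph d) :
    |inner ℝ (x : EuclideanSpace ℝ (Fin d)) (y : EuclideanSpace ℝ (Fin d))| ≤ 1 := by
  simpa using abs_real_inner_le_norm (x : EuclideanSpace ℝ (Fin d)) (y : EuclideanSpace ℝ (Fin d))

/-- The orthogonal projection is given by integration against the zonal kernel. -/
lemma proj_ae_eq (hd : 3 ≤ d) {lam : ℝ} (hlam : (d : ℝ) = 2 * lam + 2) {k : ℕ}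
    {T : Lp ℝ 2 (sphMeasure d) → Lp ℝ 2 (sphMeasure d)} (hT : IsOrthProjOnto d k T)
    (f : Lp ℝ 2 (sphMeasure d)) :
    T f =ᵐ[sphMeasure d] fun x => ((sphMeasure d).real Set.univ)⁻¹ *
      ∫ y : Sph d, zon lam k (inner ℝ (x : EuclideanSpace ℝ (Fin d)) y) * f y ∂(sphMeasure d) := by
  obtain ⟨P, hP, hfP⟩ := exists_polyLp_eq (hT f).1
  have hd' : (3 : ℝ) ≤ d := by exact_mod_cast hd
  have hl : 0 < lam := by linarith
  have hS := sphMeasure_real_univ_pos hd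
  rw [hfP]
  filter_upwards [coeFn_polyLp P] with x hx
  rw [hx]
  have hx1 : ‖(x : EuclideanSpace ℝ (Fin d))‖ = 1 := by simp
  have hG := harm_geg hlam hx1 k
  have h1 := (hT f).2 _ (polyLp_mem hG)
  rw [inner_sub_left, hfP, inner_polyLp, inner_polyLp, sub_eq_zero] at h1
  have h2 : ∫ y : Sph d, pev (geg lam (linF (x : EuclideanSpace ℝ (Fin d))) (normSqP d) k)
      (y : EuclideanSpace ℝ (Fin d)) * polyLp P y ∂(sphMeasure d) =
      sphInt (geg lam (linF (x : EuclideanSpace ℝ (Fin d))) (normSqP d) k * P) := by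
    refine integral_congr_ae ?_
    filter_upwards [coeFn_polyLp P] with y hy
    rw [hy, pev_mul]
  have h3 := sphInt_geg_mul hd hlam hx1 hP
  rw [← h2, ← h1] at h3
  have h4 : ∫ y : Sph d, zon lam k (inner ℝ (x : EuclideanSpace ℝ (Fin d)) y) * f y
      ∂(sphMeasure d) = ((k + lam) / lam) * ∫ y : Sph d,
        pev (geg lam (linF (x : EuclideanSpace ℝ (Fin d))) (normSqP d) k)
        (y : EuclideanSpace ℝ (Fin d)) * f y ∂(sphMeasure d) := by
    rw [← integral_const_mul]
    congr 1; ext y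
    rw [pev_geg lam _ _ (by simp), zon, mul_assoc]
  rw [h4, div_mul_eq_mul_div, h3]
  field_simp

lemma proj_inner_symm {k : ℕ} {T : Lp ℝ 2 (sphMeasure d) → Lp ℝ 2 (sphMeasure d)}
    (hT : IsOrthProjOnto d k T) (f g : Lp ℝ 2 (sphMeasure d)) :
    inner ℝ (T f) g = inner ℝ (T f) (T g) := by
  have h := (hT g).2 _ (hT f).1
  rw [inner_sub_left, sub_eq_zero] at h
  rw [real_inner_comm, h, real_inner_comm]

lemma proj_add {k : ℕ} {T : Lp ℝ 2 (sphMeasure d) → Lp ℝ 2 (sphMeasure d)}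
    (hT : IsOrthProjOnto d k T) (f g : Lp ℝ 2 (sphMeasure d)) : T (f + g) = T f + T g := by
  have h : T (f + g) - (T f + T g) ∈ Hspace d k :=
    Submodule.sub_mem _ (hT _).1 (Submodule.add_mem _ (hT _).1 (hT _).1)
  rw [← sub_eq_zero, ← inner_self_eq_zero (𝕜 := ℝ)]
  set u := T (f + g) - (T f + T g) with hu
  have h1 := (hT f).2 _ h
  have h2 := (hT g).2 _ h
  have h3 := (hT (f + g)).2 _ h
  have : u = (f - T f) + (g - T g) - ((f + g) - T (f + g)) := by rw [hu]; abel
  have h4 : inner ℝ u u = inner ℝ (f - T f) u + inner ℝ (g - T g) u -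
      inner ℝ (f + g - T (f + g)) u := by
    rw [← inner_add_left, ← inner_sub_left, ← this]
  rw [h4, h1, h2, h3]; simp

lemma proj_norm_sq {k : ℕ} {T : Lp ℝ 2 (sphMeasure d) → Lp ℝ 2 (sphMeasure d)}
    (hT : IsOrthProjOnto d k T) (f : Lp ℝ 2 (sphMeasure d)) :
    ‖T f‖ ^ 2 = inner ℝ (T f) f := by
  rw [proj_inner_symm hT, real_inner_self_eq_norm_sq]

lemma proj_norm_le {k : ℕ} {T : Lp ℝ 2 (sphMeasure d) → Lp ℝ 2 (sphMeasure d)}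
    (hT : IsOrthProjOnto d k T) (f : Lp ℝ 2 (sphMeasure d)) : ‖T f‖ ≤ ‖f‖ := by
  have h := proj_norm_sq hT f
  have h2 := real_inner_le_norm (T f) f
  rw [← h, pow_two] at h2
  rcases (norm_nonneg (T f)).eq_or_lt with h0 | h0
  · rw [← h0]; exact norm_nonneg _
  · exact le_of_mul_le_mul_left h2 h0

lemma Hspace_orthogonal (hd : 3 ≤ d) {k l : ℕ} (hkl : k ≠ l) {f g : Lp ℝ 2 (sphMeasure d)}
    (hf : f ∈ Hspace d k) (hg : g ∈ Hspace d l) : inner ℝ f g = 0 := by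
  obtain ⟨P, hP, rfl⟩ := exists_polyLp_eq hf
  obtain ⟨Q, hQ, rfl⟩ := exists_polyLp_eq hg
  rw [inner_polyLp, ← sphInt_mul_eq_zero hd hkl.symm hQ hP]
  refine integral_congr_ae ?_
  filter_upwards [coeFn_polyLp P] with y hy
  rw [hy, pev_mul]

/-- Bessel's inequality for the projections onto spaces of spherical harmonics. -/
lemma proj_bessel (hd : 3 ≤ d) {proj : ℕ → Lp ℝ 2 (sphMeasure d) → Lp ℝ 2 (sphMeasure d)}
    (hproj : ∀ k, IsOrthProjOnto d k (proj k)) (s : Finset ℕ) (f : Lp ℝ 2 (sphMeasure d)) :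
    ∑ k ∈ s, ‖proj k f‖ ^ 2 ≤ ‖f‖ ^ 2 := by
  set u := ∑ k ∈ s, proj k f with hu
  have h1 : inner ℝ u u = ∑ k ∈ s, ‖proj k f‖ ^ 2 := by
    rw [hu, sum_inner]
    refine Finset.sum_congr rfl fun k hk => ?_
    rw [inner_sum, Finset.sum_eq_single_of_mem k hk, real_inner_self_eq_norm_sq]
    intro l _ hl
    exact Hspace_orthogonal hd hl.symm (hproj k f).1 (hproj l f).1
  have h2 : inner ℝ u f = ∑ k ∈ s, ‖proj k f‖ ^ 2 := by
    rw [hu, sum_inner]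
    exact Finset.sum_congr rfl fun k _ => (proj_norm_sq (hproj k) f).symm
  have h3 := real_inner_self_nonneg (x := f - u)
  rw [inner_sub_left, inner_sub_right, inner_sub_right, real_inner_comm u f, h1, h2,
    real_inner_self_eq_norm_sq] at h3
  linarith

end Projection

section KernelBound

open Real in
lemma le_norm_one_sub_exp {ρ s : ℝ} (h1 : 1 / 2 ≤ ρ) (h2 : ρ < 1) (hs : |s| ≤ π) :
    (1 - ρ + |s|) / π ≤ ‖1 - (ρ : ℂ) * Complex.exp (s * Complex.I)‖ := by
  have hn : ‖1 - (ρ : ℂ) * Complex.exp (s * Complex.I)‖ ^ 2 =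
      (1 - ρ) ^ 2 + 4 * ρ * sin (s / 2) ^ 2 := by
    rw [← Complex.normSq_eq_norm_sq, Complex.exp_mul_I, ← Complex.ofReal_cos, ← Complex.ofReal_sin,
      Complex.normSq_apply]
    have hc : cos s = 1 - 2 * sin (s / 2) ^ 2 := by
      have := cos_sq_add_sin_sq (s / 2)
      have h := cos_two_mul (s / 2)
      rw [show 2 * (s / 2) = s by ring] at h
      linarith
    have hcs := cos_sq_add_sin_sq s
    simp only [Complex.sub_re, Complex.one_re, Complex.add_re,
      Complex.ofReal_re, Complex.mul_re, Complex.I_re, mul_zero, Complex.ofReal_im, Complex.I_im,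
      Complex.sub_im, Complex.one_im, Complex.add_im, Complex.mul_im]
    nlinarith
  have hsin : (s / π) ^ 2 ≤ sin (s / 2) ^ 2 := by
    have h := mul_abs_le_abs_sin (x := s / 2) (by rw [abs_div, abs_two]; linarith)
    rw [← sq_abs (s / π), ← sq_abs (sin (s / 2))]
    have : |s / π| = 2 / π * |s / 2| := by
      rw [abs_div, abs_div, abs_two, abs_of_pos pi_pos]; ring
    rw [this]
    gcongr
  have hpi : (2 : ℝ) ≤ π ^ 2 := by nlinarith [pi_gt_three]
  apply le_of_sq_le_sq _ (norm_nonneg _)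
  rw [hn, div_pow, div_le_iff₀ (by positivity)]
  have h3 : (s / π) ^ 2 * π ^ 2 = s ^ 2 := by field_simp
  have h4 : s ^ 2 ≤ sin (s / 2) ^ 2 * π ^ 2 := by rw [← h3]; gcongr
  have h5 : |s| ^ 2 = s ^ 2 := sq_abs s
  nlinarith [sq_nonneg (1 - ρ - |s|), sq_nonneg (1 - ρ), sq_nonneg (sin (s / 2) * π)]

open Real in
lemma integral_norm_rpow_le {lam ρ : ℝ} (hl : 0 < lam) (h1 : 1 / 2 ≤ ρ) (h2 : ρ < 1) (α : ℝ) :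
    ∫ ψ in (0 : ℝ)..2 * π, ‖1 - Complex.exp (α * Complex.I) * circleMap 0 ρ ψ‖ ^ (-(lam + 1)) ≤
      2 * π ^ (lam + 1) / lam * (1 - ρ) ^ (-lam) := by
  set h : ℝ → ℝ := fun s => ‖1 - (ρ : ℂ) * Complex.exp (s * Complex.I)‖ ^ (-(lam + 1)) with hh
  have hper : Function.Periodic h (2 * π) := by
    intro s
    simp only [hh]
    have : Complex.exp ((↑(s + 2 * π) : ℂ) * Complex.I) = Complex.exp (s * Complex.I) := by
      push_cast; rw [add_mul, Complex.exp_add, Complex.exp_two_pi_mul_I, mul_one]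
    rw [this]
  have hne : ∀ s : ℝ, ‖1 - (ρ : ℂ) * Complex.exp (s * Complex.I)‖ ≠ 0 := by
    intro s hs
    rw [norm_eq_zero, sub_eq_zero] at hs
    have := congrArg norm hs
    rw [norm_mul, Complex.norm_exp_ofReal_mul_I, Complex.norm_real, norm_one, mul_one,
      norm_of_nonneg (by linarith)] at this
    linarith
  have hcont : Continuous h := by
    refine Continuous.rpow_const (by fun_prop) fun s => Or.inl (hne s)
  have e1 : ∫ ψ in (0 : ℝ)..2 * π,
      ‖1 - Complex.exp (α * Complex.I) * circleMap 0 ρ ψ‖ ^ (-(lam + 1)) =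
      ∫ ψ in (0 : ℝ)..2 * π, h (ψ + α) := by
    congr 1; ext ψ
    simp only [hh, circleMap, zero_add]
    push_cast
    rw [add_mul, Complex.exp_add]
    ring_nf
  have e2 : ∫ ψ in (0 : ℝ)..2 * π, h (ψ + α) = ∫ s in (-π)..π, h s := by
    rw [intervalIntegral.integral_comp_add_right, zero_add, add_comm (2 * π) α,
      hper.intervalIntegral_add_eq α (-π)]
    congr 1; ring
  have hδ : 0 < 1 - ρ := by linarith
  have hb : ∀ s, |s| ≤ π → h s ≤ π ^ (lam + 1) * (1 - ρ + |s|) ^ (-(lam + 1)) := by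
    intro s hs
    have h3 := le_norm_one_sub_exp h1 h2 hs
    have h4 : 0 < (1 - ρ + |s|) / π := by positivity
    calc h s ≤ ((1 - ρ + |s|) / π) ^ (-(lam + 1)) :=
          rpow_le_rpow_of_nonpos h4 h3 (by linarith)
      _ = _ := by
          rw [div_rpow (by positivity) pi_pos.le, rpow_neg pi_pos.le, div_inv_eq_mul, mul_comm]
  have hg : ContinuousOn (fun s : ℝ => π ^ (lam + 1) * (1 - ρ + s) ^ (-(lam + 1))) (Set.Icc 0 π) := by
    refine continuousOn_const.mul (ContinuousOn.rpow_const (by fun_prop) fun s hs => Or.inl ?_)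
    have := hs.1; positivity
  have hI : ∫ s in (0 : ℝ)..π, π ^ (lam + 1) * (1 - ρ + s) ^ (-(lam + 1)) ≤
      π ^ (lam + 1) / lam * (1 - ρ) ^ (-lam) := by
    rw [intervalIntegral.integral_const_mul]
    have h5 : ∫ s in (0 : ℝ)..π, (1 - ρ + s) ^ (-(lam + 1)) =
        ∫ s in (1 - ρ)..(1 - ρ + π), s ^ (-(lam + 1)) := by
      rw [intervalIntegral.integral_comp_add_left (fun s => s ^ (-(lam + 1))), add_zero]
    have h6 := integral_rpow (a := 1 - ρ) (b := 1 - ρ + π) (r := -(lam + 1))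
      (Or.inr ⟨by linarith, by
        rw [Set.uIcc_of_le (by linarith [pi_pos])]; intro h; linarith [h.1]⟩)
    have h7 : ∫ s in (0 : ℝ)..π, (1 - ρ + s) ^ (-(lam + 1)) ≤ (1 - ρ) ^ (-lam) / lam := by
      rw [h5, h6, show -(lam + 1) + 1 = -lam by ring, div_neg, ← neg_div]
      have : 0 ≤ (1 - ρ + π) ^ (-lam) := by positivity
      exact div_le_div_of_nonneg_right (by linarith) hl.le
    calc _ ≤ π ^ (lam + 1) * ((1 - ρ) ^ (-lam) / lam) := by gcongr
      _ = _ := by ring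
  have e3 : ∫ s in (-π)..π, h s = (∫ s in (0 : ℝ)..π, h (-s)) + ∫ s in (0 : ℝ)..π, h s := by
    rw [intervalIntegral.integral_comp_neg, neg_zero,
      intervalIntegral.integral_add_adjacent_intervals (hcont.intervalIntegrable _ _)
        (hcont.intervalIntegrable _ _)]
  have hgi : IntervalIntegrable (fun s : ℝ => π ^ (lam + 1) * (1 - ρ + s) ^ (-(lam + 1)))
      volume 0 π := by
    apply ContinuousOn.intervalIntegrable; rwa [Set.uIcc_of_le pi_pos.le]
  have b1 : ∫ s in (0 : ℝ)..π, h (-s) ≤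
      ∫ s in (0 : ℝ)..π, π ^ (lam + 1) * (1 - ρ + s) ^ (-(lam + 1)) := by
    refine intervalIntegral.integral_mono_on pi_pos.le
      ((hcont.comp continuous_neg).intervalIntegrable _ _) hgi fun s hs => ?_
    have := hb (-s) (by rw [abs_neg, abs_of_nonneg hs.1]; exact hs.2)
    rwa [abs_neg, abs_of_nonneg hs.1] at this
  have b2 : ∫ s in (0 : ℝ)..π, h s ≤
      ∫ s in (0 : ℝ)..π, π ^ (lam + 1) * (1 - ρ + s) ^ (-(lam + 1)) := by
    refine intervalIntegral.integral_mono_on pi_pos.le (hcont.intervalIntegrable _ _) hgi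
      fun s hs => ?_
    have := hb s (by rw [abs_of_nonneg hs.1]; exact hs.2)
    rwa [abs_of_nonneg hs.1] at this
  rw [e1, e2, e3]
  calc _ ≤ π ^ (lam + 1) / lam * (1 - ρ) ^ (-lam) + π ^ (lam + 1) / lam * (1 - ρ) ^ (-lam) :=
        add_le_add (b1.trans hI) (b2.trans hI)
    _ = _ := by ring

end KernelBound

section CoefficientFunctional

open Real in
/-- The `k`-th Taylor coefficient at `0`, as an average over the circle of radius `ρ`. -/
def kap (ρ : ℝ) (k : ℕ) (F : ℂ → ℂ) : ℂ :=
  (2 * π : ℂ)⁻¹ * ∫ ψ in (0 : ℝ)..2 * π, F (circleMap 0 ρ ψ) * ((circleMap 0 ρ ψ)⁻¹) ^ k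

variable {ρ : ℝ} {F G : ℂ → ℂ}

lemma circleMap_mem_ball_one (h0 : 0 < ρ) (h1 : ρ < 1) (ψ : ℝ) :
    circleMap 0 ρ ψ ∈ ball (0 : ℂ) 1 := by
  simpa [abs_of_pos h0] using h1

lemma kap_congr (h0 : 0 < ρ) (h1 : ρ < 1) (h : ∀ z ∈ ball (0 : ℂ) 1, F z = G z) (k : ℕ) :
    kap ρ k F = kap ρ k G := by
  simp only [kap]
  congr 2; ext ψ
  rw [h _ (circleMap_mem_ball_one h0 h1 ψ)]

lemma continuous_kap_integrand (h0 : 0 < ρ) (h1 : ρ < 1) (hF : ContinuousOn F (ball (0 : ℂ) 1))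
    (k : ℕ) : Continuous fun ψ : ℝ => F (circleMap 0 ρ ψ) * ((circleMap 0 ρ ψ)⁻¹) ^ k := by
  have hc : Continuous (circleMap 0 ρ) := continuous_circleMap 0 ρ
  refine (hF.comp_continuous hc (circleMap_mem_ball_one h0 h1)).mul
    ((hc.inv₀ fun ψ => circleMap_ne_center h0.ne').pow k)

lemma kap_add (h0 : 0 < ρ) (h1 : ρ < 1) (hF : ContinuousOn F (ball (0 : ℂ) 1))
    (hG : ContinuousOn G (ball (0 : ℂ) 1)) (k : ℕ) :
    kap ρ k (fun z => F z + G z) = kap ρ k F + kap ρ k G := by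
  simp only [kap, add_mul]
  rw [intervalIntegral.integral_add
    ((continuous_kap_integrand h0 h1 hF k).intervalIntegrable _ _)
    ((continuous_kap_integrand h0 h1 hG k).intervalIntegrable _ _), mul_add]

lemma kap_const_mul (c : ℂ) (F : ℂ → ℂ) (k : ℕ) :
    kap ρ k (fun z => c * F z) = c * kap ρ k F := by
  simp only [kap, mul_assoc]
  rw [intervalIntegral.integral_const_mul]; ring

lemma kap_id_mul (h0 : 0 < ρ) (F : ℂ → ℂ) (k : ℕ) :
    kap ρ (k + 1) (fun z => z * F z) = kap ρ k F := by
  simp only [kap]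
  congr 2; ext ψ
  have : circleMap 0 ρ ψ ≠ 0 := circleMap_ne_center h0.ne'
  rw [pow_succ]; field_simp

open Real in
lemma kap_zero (h0 : 0 < ρ) (h1 : ρ < 1) (hF : DifferentiableOn ℂ F (ball (0 : ℂ) 1)) :
    kap ρ 0 F = F 0 := by
  have hd : DiffContOnCl ℂ F (ball 0 |ρ|) := by
    apply DifferentiableOn.diffContOnCl
    refine hF.mono (closure_ball_subset_closedBall.trans ?_)
    rw [abs_of_pos h0]; exact closedBall_subset_ball h1
  rw [← hd.circleAverage, Real.circleAverage, kap]
  simp [Complex.real_smul]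

lemma kap_zero_id_mul (h0 : 0 < ρ) (h1 : ρ < 1) (hF : DifferentiableOn ℂ F (ball (0 : ℂ) 1)) :
    kap ρ 0 (fun z => z * F z) = 0 := by
  have h : DifferentiableOn ℂ (fun z => z * F z) (ball (0 : ℂ) 1) := differentiableOn_id.mul hF
  rw [kap_zero h0 h1 h, zero_mul]

open Real in
lemma kap_deriv (h0 : 0 < ρ) (h1 : ρ < 1) {F' : ℂ → ℂ}
    (hF : ∀ z ∈ ball (0 : ℂ) 1, HasDerivAt F (F' z) z) (hF' : ContinuousOn F' (ball (0 : ℂ) 1))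
    (k : ℕ) : kap ρ k F' = (k + 1) * kap ρ (k + 1) F := by
  have hFc : ContinuousOn F (ball (0 : ℂ) 1) := fun z hz => (hF z hz).continuousAt.continuousWithinAt
  have h := circleIntegral.integral_eq_zero_of_hasDerivWithinAt (c := (0 : ℂ)) (R := ρ) h0.le
    (f := fun z => F z * (z⁻¹) ^ (k + 1))
    (f' := fun z => F' z * (z⁻¹) ^ (k + 1) - (k + 1) * (F z * (z⁻¹) ^ (k + 2))) (by
      intro z hz
      have hz0 : z ≠ 0 := by
        rintro rfl; simp at hz; linarith
      have hzb : z ∈ ball (0 : ℂ) 1 := by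
        simp only [mem_sphere_iff_norm, sub_zero] at hz
        simpa [hz] using h1
      have h2 := (hF z hzb).mul ((hasDerivAt_inv hz0).pow (k + 1))
      refine HasDerivAt.hasDerivWithinAt ?_
      convert! h2 using 1
      simp only [Nat.add_sub_cancel, Pi.pow_apply]
      push_cast
      have e2 : (z⁻¹) ^ (k + 2) = z⁻¹ ^ k * (z ^ 2)⁻¹ := by rw [pow_add, inv_pow z 2]
      rw [e2]; ring)
  have e : (∮ z in C((0 : ℂ), ρ), (F' z * (z⁻¹) ^ (k + 1) - (k + 1) * (F z * (z⁻¹) ^ (k + 2)))) =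
      Complex.I * ∫ ψ in (0 : ℝ)..2 * π, (F' (circleMap 0 ρ ψ) * ((circleMap 0 ρ ψ)⁻¹) ^ k -
        (k + 1) * (F (circleMap 0 ρ ψ) * ((circleMap 0 ρ ψ)⁻¹) ^ (k + 1))) := by
    rw [circleIntegral, ← intervalIntegral.integral_const_mul]
    congr 1; ext ψ
    have : circleMap 0 ρ ψ ≠ 0 := circleMap_ne_center h0.ne'
    rw [deriv_circleMap, smul_eq_mul, pow_succ _ (k + 1), pow_succ _ k]
    field_simp
  rw [e] at h
  have h3 := (mul_eq_zero.1 h).resolve_left Complex.I_ne_zero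
  rw [intervalIntegral.integral_sub
    ((continuous_kap_integrand h0 h1 hF' k).intervalIntegrable _ _)
    (((continuous_kap_integrand h0 h1 hFc (k + 1)).const_mul _).intervalIntegrable _ _),
    intervalIntegral.integral_const_mul, sub_eq_zero] at h3
  rw [kap, kap, h3]; ring

lemma kap_id_mul_deriv (h0 : 0 < ρ) (h1 : ρ < 1) {F' : ℂ → ℂ}
    (hF : ∀ z ∈ ball (0 : ℂ) 1, HasDerivAt F (F' z) z)
    (hF' : DifferentiableOn ℂ F' (ball (0 : ℂ) 1)) (k : ℕ) :
    kap ρ k (fun z => z * F' z) = k * kap ρ k F := by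
  cases k with
  | zero => simpa using kap_zero_id_mul h0 h1 hF'
  | succ k =>
    rw [kap_id_mul h0, kap_deriv h0 h1 hF hF'.continuousOn]; push_cast; ring

lemma kap_pow_mul (h0 : 0 < ρ) (h1 : ρ < 1) (hF : DifferentiableOn ℂ F (ball (0 : ℂ) 1))
    (m k : ℕ) : kap ρ k (fun z => z ^ m * F z) = if m ≤ k then kap ρ (k - m) F else 0 := by
  induction m generalizing k with
  | zero => simp
  | succ m ih =>
    have e : (fun z => z ^ (m + 1) * F z) = fun z => z * (z ^ m * F z) := by
      ext z; ring
    rw [e]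
    cases k with
    | zero =>
      have : DifferentiableOn ℂ (fun z => z ^ m * F z) (ball (0 : ℂ) 1) :=
        (differentiableOn_id.pow m).mul hF
      simpa using kap_zero_id_mul h0 h1 this
    | succ k =>
      rw [kap_id_mul h0, ih]
      simp

end CoefficientFunctional

section GeneratingFunction

open ComplexConjugate

/-- The generating function of the Gegenbauer polynomials. -/
def genF (lam : ℝ) (a : ℂ) (z : ℂ) : ℂ := (1 - a * z) ^ (-lam : ℂ) * (1 - conj a * z) ^ (-lam : ℂ)

lemma one_sub_mem_slitPlane {a z : ℂ} (ha : ‖a‖ = 1) (hz : z ∈ ball (0 : ℂ) 1) :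
    1 - a * z ∈ Complex.slitPlane := by
  have h : ‖-(a * z)‖ < 1 := by
    rw [norm_neg, norm_mul, ha, one_mul]; simpa using hz
  simpa only [sub_eq_add_neg] using Complex.mem_slitPlane_of_norm_lt_one h

lemma hasDerivAt_cpow_aux {lam : ℝ} {a z : ℂ} (ha : ‖a‖ = 1) (hz : z ∈ ball (0 : ℂ) 1) :
    HasDerivAt (fun z => (1 - a * z) ^ (-lam : ℂ))
      (lam * a * ((1 - a * z) ^ (-lam : ℂ) / (1 - a * z))) z := by
  have hs := one_sub_mem_slitPlane ha hz
  have h0 := Complex.slitPlane_ne_zero hs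
  have h := (((hasDerivAt_id z).const_mul a).const_sub 1).cpow_const (c := (-lam : ℂ)) hs
  convert! h using 1
  simp only [id]
  rw [Complex.cpow_sub _ _ h0, Complex.cpow_one]
  ring

lemma hasDerivAt_genF {lam : ℝ} {a z : ℂ} (ha : ‖a‖ = 1) (hz : z ∈ ball (0 : ℂ) 1) :
    HasDerivAt (genF lam a)
      (2 * lam * ((a.re - z) * (genF lam a z / ((1 - a * z) * (1 - conj a * z))))) z := by
  have ha' : ‖conj a‖ = 1 := by rwa [RCLike.norm_conj]
  have h := (hasDerivAt_cpow_aux (lam := lam) ha hz).mul (hasDerivAt_cpow_aux (lam := lam) ha' hz)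
  convert! h using 1
  have h1 := Complex.slitPlane_ne_zero (one_sub_mem_slitPlane ha hz)
  have h2 := Complex.slitPlane_ne_zero (one_sub_mem_slitPlane ha' hz)
  have h3 : a + conj a = 2 * a.re := Complex.add_conj a ▸ by push_cast; ring
  have h4 : a * conj a = 1 := by rw [Complex.mul_conj, Complex.normSq_eq_norm_sq, ha]; simp
  rw [genF]
  generalize (1 - a * z) ^ (-lam : ℂ) = p
  generalize (1 - conj a * z) ^ (-lam : ℂ) = q
  have e1 : lam * a * (p / (1 - a * z)) * q + p * (lam * conj a * (q / (1 - conj a * z))) =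
      lam * (p * q / ((1 - a * z) * (1 - conj a * z))) *
        (a * (1 - conj a * z) + conj a * (1 - a * z)) := by
    generalize 1 - a * z = u at h1 ⊢
    generalize 1 - conj a * z = v at h2 ⊢
    field_simp
  rw [e1]
  have e2 : a * (1 - conj a * z) + conj a * (1 - a * z) = 2 * (a.re - z) := by
    linear_combination h3 - 2 * z * h4
  rw [e2]; ring

end GeneratingFunction

section ZonalBound

open ComplexConjugate

variable {ρ lam : ℝ} {a : ℂ}

lemma differentiableOn_genF (ha : ‖a‖ = 1) : DifferentiableOn ℂ (genF lam a) (ball (0 : ℂ) 1) :=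
  fun _ hz => (hasDerivAt_genF ha hz).differentiableAt.differentiableWithinAt

lemma genF_quad (ha : ‖a‖ = 1) (z : ℂ) :
    (1 - a * z) * (1 - conj a * z) = 1 - 2 * a.re * z + z ^ 2 := by
  have h3 : a + conj a = 2 * a.re := Complex.add_conj a ▸ by push_cast; ring
  have h4 : a * conj a = 1 := by rw [Complex.mul_conj, Complex.normSq_eq_norm_sq, ha]; simp
  linear_combination -z * h3 + z ^ 2 * h4

lemma quad_ne_zero (ha : ‖a‖ = 1) {z : ℂ} (hz : z ∈ ball (0 : ℂ) 1) :
    (1 - a * z) * (1 - conj a * z) ≠ 0 :=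
  mul_ne_zero (Complex.slitPlane_ne_zero (one_sub_mem_slitPlane ha hz))
    (Complex.slitPlane_ne_zero (one_sub_mem_slitPlane (by rwa [RCLike.norm_conj]) hz))

lemma differentiableOn_genF_div (ha : ‖a‖ = 1) :
    DifferentiableOn ℂ (fun z => genF lam a z / ((1 - a * z) * (1 - conj a * z)))
      (ball (0 : ℂ) 1) :=
  (differentiableOn_genF ha).div (by fun_prop) fun _ hz => quad_ne_zero ha hz

/-- Gegenbauer polynomials are the Taylor coefficients of their generating function. -/
lemma geg_eq_kap (h0 : 0 < ρ) (h1 : ρ < 1) (ha : ‖a‖ = 1) (k : ℕ) :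
    ((geg lam a.re (1 : ℝ) k : ℝ) : ℂ) = kap ρ k (genF lam a) := by
  set F := genF lam a with hF
  set F' : ℂ → ℂ := fun z =>
    2 * lam * ((a.re - z) * (genF lam a z / ((1 - a * z) * (1 - conj a * z)))) with hF'
  have hd : ∀ z ∈ ball (0 : ℂ) 1, HasDerivAt F (F' z) z := fun z hz => hasDerivAt_genF ha hz
  have hFd : DifferentiableOn ℂ F (ball (0 : ℂ) 1) := differentiableOn_genF ha
  have hF'd : DifferentiableOn ℂ F' (ball (0 : ℂ) 1) := by
    refine DifferentiableOn.const_mul (DifferentiableOn.mul (by fun_prop) ?_) _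
    exact differentiableOn_genF_div ha
  have hzF : DifferentiableOn ℂ (fun z => z * F z) (ball (0 : ℂ) 1) := differentiableOn_id.mul hFd
  have hzF' : DifferentiableOn ℂ (fun z => z * F' z) (ball (0 : ℂ) 1) :=
    differentiableOn_id.mul hF'd
  have hzzF' : DifferentiableOn ℂ (fun z => z * (z * F' z)) (ball (0 : ℂ) 1) :=
    differentiableOn_id.mul hzF'
  have key : ∀ k : ℕ, (k + 1) * kap ρ (k + 1) F = 2 * lam * a.re * kap ρ k F +
      (-2 * lam) * kap ρ k (fun z => z * F z) + 2 * a.re * (k * kap ρ k F) +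
      (-1) * kap ρ k (fun z => z * (z * F' z)) := by
    intro k
    have c2 : ∀ α β : ℂ, ContinuousOn (fun z => α * F z + β * (z * F z)) (ball (0 : ℂ) 1) :=
      fun _ _ => (hFd.const_mul _).continuousOn.add (hzF.const_mul _).continuousOn
    have c3 : ∀ α β γ : ℂ, ContinuousOn
        (fun z => α * F z + β * (z * F z) + γ * (z * F' z)) (ball (0 : ℂ) 1) :=
      fun _ _ _ => (c2 _ _).add (hzF'.const_mul _).continuousOn
    rw [← kap_deriv h0 h1 hd hF'd.continuousOn, ← kap_id_mul_deriv h0 h1 hd hF'd,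
      ← kap_const_mul, ← kap_const_mul, ← kap_const_mul, ← kap_const_mul,
      ← kap_add h0 h1 (hFd.const_mul _).continuousOn (hzF.const_mul _).continuousOn,
      ← kap_add h0 h1 (c2 _ _) (hzF'.const_mul _).continuousOn,
      ← kap_add h0 h1 (c3 _ _ _) (hzzF'.const_mul _).continuousOn]
    refine kap_congr h0 h1 (fun z hz => ?_) k
    have hq := quad_ne_zero ha hz
    have e : F' z * ((1 - a * z) * (1 - conj a * z)) = 2 * lam * ((a.re - z) * F z) := by
      rw [hF', hF, mul_assoc, mul_assoc (_ - _), div_mul_cancel₀ _ hq]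
    rw [genF_quad ha] at e
    linear_combination e
  have hF0 : kap ρ 0 F = 1 := by
    rw [kap_zero h0 h1 hFd]; simp [hF, genF]
  induction k using Nat.twoStepInduction with
  | zero => simp [geg, hF0]
  | one =>
    have := key 0
    rw [kap_zero_id_mul h0 h1 hFd, kap_zero_id_mul h0 h1 hzF', hF0] at this
    simp only [zero_add] at this ⊢
    simp only [geg, smul_eq_mul]; push_cast at this ⊢
    linear_combination -this
  | more k ih1 ih2 =>
    have := key (k + 1)
    rw [kap_id_mul h0, kap_id_mul h0, kap_id_mul_deriv h0 h1 hd hF'd, ← ih1, ← ih2] at this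
    have hr := geg_rec lam a.re (1 : ℝ) k
    simp only [smul_eq_mul, one_mul] at hr
    have hr' := congrArg (fun x : ℝ => (x : ℂ)) hr
    push_cast at hr' this
    have hk : ((k : ℂ) + 2) ≠ 0 := by
      have : ((k + 2 : ℕ) : ℂ) ≠ 0 := by exact_mod_cast (by omega : k + 2 ≠ 0)
      exact_mod_cast this
    apply mul_left_cancel₀ hk
    linear_combination hr' - this

/-- The generating function of the zonal polynomials. -/
def poisF (lam : ℝ) (a : ℂ) (z : ℂ) : ℂ :=
  (1 - z ^ 2) * (genF lam a z / ((1 - a * z) * (1 - conj a * z)))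

lemma differentiableOn_poisF (ha : ‖a‖ = 1) : DifferentiableOn ℂ (poisF lam a) (ball (0 : ℂ) 1) :=
  DifferentiableOn.mul (by fun_prop) (differentiableOn_genF_div ha)

lemma zon_eq_kap (hl : 0 < lam) (h0 : 0 < ρ) (h1 : ρ < 1) (ha : ‖a‖ = 1) (k : ℕ) :
    ((zon lam k a.re : ℝ) : ℂ) = kap ρ k (poisF lam a) := by
  set F' : ℂ → ℂ := fun z =>
    2 * lam * ((a.re - z) * (genF lam a z / ((1 - a * z) * (1 - conj a * z)))) with hF'
  have hd : ∀ z ∈ ball (0 : ℂ) 1, HasDerivAt (genF lam a) (F' z) z :=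
    fun z hz => hasDerivAt_genF ha hz
  have hF'd : DifferentiableOn ℂ F' (ball (0 : ℂ) 1) :=
    DifferentiableOn.const_mul (DifferentiableOn.mul (by fun_prop) (differentiableOn_genF_div ha)) _
  have hzF' : DifferentiableOn ℂ (fun z => z * F' z) (ball (0 : ℂ) 1) :=
    differentiableOn_id.mul hF'd
  have hlc : (lam : ℂ) ≠ 0 := by exact_mod_cast hl.ne'
  have e : kap ρ k (poisF lam a) = kap ρ k (fun z => genF lam a z + (lam : ℂ)⁻¹ * (z * F' z)) := by
    refine kap_congr h0 h1 (fun z hz => ?_) k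
    have hq := quad_ne_zero ha hz
    have e1 : genF lam a z = (1 - 2 * a.re * z + z ^ 2) *
        (genF lam a z / ((1 - a * z) * (1 - conj a * z))) := by
      rw [← genF_quad ha, mul_div_cancel₀ _ hq]
    rw [poisF]
    conv_rhs => rw [e1]
    simp only [hF']
    generalize genF lam a z / ((1 - a * z) * (1 - conj a * z)) = w
    field_simp; ring
  rw [e, kap_add h0 h1 (differentiableOn_genF ha).continuousOn (hzF'.const_mul _).continuousOn,
    kap_const_mul, kap_id_mul_deriv h0 h1 hd hF'd, ← geg_eq_kap h0 h1 ha, zon]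
  push_cast; field_simp; ring

lemma kap_sum {ι : Type*} (h0 : 0 < ρ) (h1 : ρ < 1) (s : Finset ι) (F : ι → ℂ → ℂ)
    (hF : ∀ i, ContinuousOn (F i) (ball (0 : ℂ) 1)) (k : ℕ) :
    kap ρ k (fun z => ∑ i ∈ s, F i z) = ∑ i ∈ s, kap ρ k (F i) := by
  classical
  induction s using Finset.induction_on with
  | empty => simp [kap]
  | insert i s hi ih =>
    simp only [Finset.sum_insert hi]
    rw [kap_add h0 h1 (hF i) (continuousOn_finsetSum s fun i _ => hF i), ih]

/-- The combination of zonal polynomials with the coefficients of a polynomial. -/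
def zonComb (lam : ℝ) (B : Polynomial ℝ) (k : ℕ) (t : ℝ) : ℝ :=
  ∑ j ∈ Finset.range (B.natDegree + 1), B.coeff j * if 2 * j ≤ k then zon lam (k - 2 * j) t else 0

lemma zonComb_eq_kap (hl : 0 < lam) (h0 : 0 < ρ) (h1 : ρ < 1) (ha : ‖a‖ = 1) (B : Polynomial ℝ)
    (k : ℕ) : ((zonComb lam B k a.re : ℝ) : ℂ) =
      kap ρ k (fun z => Polynomial.aeval (z ^ 2) B * poisF lam a z) := by
  have hP := differentiableOn_poisF (lam := lam) ha
  have e : (fun z => Polynomial.aeval (z ^ 2) B * poisF lam a z) = fun z =>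
      ∑ j ∈ Finset.range (B.natDegree + 1), (B.coeff j : ℂ) * (z ^ (2 * j) * poisF lam a z) := by
    ext z
    rw [Polynomial.aeval_eq_sum_range, Finset.sum_mul]
    refine Finset.sum_congr rfl fun j _ => ?_
    rw [Complex.real_smul, pow_mul]; ring
  rw [e, kap_sum h0 h1, zonComb]
  · push_cast
    refine Finset.sum_congr rfl fun j _ => ?_
    rw [kap_const_mul, kap_pow_mul h0 h1 hP]
    split_ifs with h
    · rw [zon_eq_kap hl h0 h1 ha]
    · simp
  · intro j
    exact (((differentiableOn_id.pow (2 * j)).mul hP).const_mul _).continuousOn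

lemma norm_cpow_neg {w : ℂ} (hw : w ≠ 0) : ‖w ^ (-lam : ℂ)‖ = ‖w‖ ^ (-lam) := by
  rw [← Complex.ofReal_neg, Complex.norm_cpow_of_ne_zero hw]; simp

open Real in
lemma norm_poisF_mul_le (hl : 0 < lam) (ha : ‖a‖ = 1) {z : ℂ} (hz : z ∈ ball (0 : ℂ) 1) :
    ‖1 - z ^ 2‖ ^ lam * ‖poisF lam a z‖ ≤ 2 ^ (lam + 1) *
      (‖1 - a * z‖ ^ (-(lam + 1)) + ‖1 - conj a * z‖ ^ (-(lam + 1))) := by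
  have ha' : ‖conj a‖ = 1 := by rwa [RCLike.norm_conj]
  have h1 := Complex.slitPlane_ne_zero (one_sub_mem_slitPlane ha hz)
  have h2 := Complex.slitPlane_ne_zero (one_sub_mem_slitPlane ha' hz)
  have h4 : a * conj a = 1 := by rw [Complex.mul_conj, Complex.normSq_eq_norm_sq, ha]; simp
  have hz1 : ‖z‖ < 1 := by simpa using hz
  have hW : ‖1 - z ^ 2‖ ≤ ‖1 - a * z‖ + ‖1 - conj a * z‖ := by
    have e : 1 - z ^ 2 = (1 - conj a * z) + conj a * z * (1 - a * z) := by
      linear_combination z ^ 2 * h4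
    rw [e]
    refine (norm_add_le _ _).trans ?_
    rw [norm_mul, norm_mul, ha', one_mul, add_comm]
    gcongr
    exact mul_le_of_le_one_left (norm_nonneg _) hz1.le
  rw [poisF, genF, norm_mul, norm_div, norm_mul, norm_mul, norm_cpow_neg h1, norm_cpow_neg h2]
  have hX := norm_pos_iff.2 h1
  have hY := norm_pos_iff.2 h2
  have hW0 := norm_nonneg (1 - z ^ 2)
  generalize ‖1 - a * z‖ = X at *
  generalize ‖1 - conj a * z‖ = Y at *
  generalize ‖1 - z ^ 2‖ = W at *
  have e : W ^ lam * (W * (X ^ (-lam) * Y ^ (-lam) / (X * Y))) = (W / (X * Y)) ^ (lam + 1) := by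
    rw [div_rpow hW0 (by positivity), mul_rpow hX.le hY.le,
      rpow_add_one' hW0 (by positivity), rpow_add_one hX.ne', rpow_add_one hY.ne',
      rpow_neg hX.le, rpow_neg hY.le]
    have := (rpow_pos_of_pos hX lam).ne'
    have := (rpow_pos_of_pos hY lam).ne'
    field_simp
  rw [e]
  have e2 : W / (X * Y) ≤ X⁻¹ + Y⁻¹ := by
    rw [div_le_iff₀ (by positivity)]
    calc W ≤ X + Y := hW
      _ = _ := by field_simp; ring
  have hmax : ∀ x y : ℝ, 0 ≤ x → 0 ≤ y → x ≤ y →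
      (x + y) ^ (lam + 1) ≤ 2 ^ (lam + 1) * (x ^ (lam + 1) + y ^ (lam + 1)) := by
    intro x y hx hy hxy
    calc (x + y) ^ (lam + 1) ≤ (2 * y) ^ (lam + 1) := by gcongr; linarith
      _ = 2 ^ (lam + 1) * y ^ (lam + 1) := mul_rpow (by norm_num) hy
      _ ≤ _ := by gcongr; have := rpow_nonneg hx (lam + 1); linarith
  calc (W / (X * Y)) ^ (lam + 1) ≤ (X⁻¹ + Y⁻¹) ^ (lam + 1) := by gcongr
    _ ≤ 2 ^ (lam + 1) * (X⁻¹ ^ (lam + 1) + Y⁻¹ ^ (lam + 1)) := by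
      rcases le_total X⁻¹ Y⁻¹ with h | h
      · exact hmax _ _ (by positivity) (by positivity) h
      · rw [add_comm X⁻¹, add_comm (X⁻¹ ^ _)]
        exact hmax _ _ (by positivity) (by positivity) h
    _ = _ := by rw [inv_rpow hX.le, inv_rpow hY.le, rpow_neg hX.le, rpow_neg hY.le]

end ZonalBound

section KernelBound

open ComplexConjugate Real

lemma continuous_norm_rpow {ρ : ℝ} (h0 : 0 < ρ) (h1 : ρ < 1) (α s : ℝ) :
    Continuous fun ψ : ℝ => ‖1 - Complex.exp (α * Complex.I) * circleMap 0 ρ ψ‖ ^ s := by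
  have hc : Continuous (circleMap 0 ρ) := continuous_circleMap 0 ρ
  refine Continuous.rpow_const (by fun_prop) fun ψ => Or.inl ?_
  rw [norm_ne_zero_iff]
  exact Complex.slitPlane_ne_zero (one_sub_mem_slitPlane (Complex.norm_exp_ofReal_mul_I α)
    (circleMap_mem_ball_one h0 h1 ψ))

lemma abs_zonComb_le_of_radius {lam ρ H : ℝ} (hl : 0 < lam) (h2 : 1 / 2 ≤ ρ) (h1 : ρ < 1)
    (hH : 0 ≤ H) (B : Polynomial ℝ)
    (hB : ∀ z : ℂ, ‖z‖ = ρ → ‖Polynomial.aeval (z ^ 2) B‖ ≤ H * ‖1 - z ^ 2‖ ^ lam) (k : ℕ)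
    {t : ℝ} (ht : |t| ≤ 1) :
    |zonComb lam B k t| ≤
      (2 * π)⁻¹ * ((ρ⁻¹) ^ k * (H * (2 ^ (lam + 1) *
        (2 * (2 * π ^ (lam + 1) / lam * (1 - ρ) ^ (-lam)))))) := by
  have h0 : 0 < ρ := by linarith
  set α := arccos t with hα
  set a : ℂ := Complex.exp (α * Complex.I) with ha'
  have ha : ‖a‖ = 1 := Complex.norm_exp_ofReal_mul_I α
  have hre : a.re = t := by
    rw [ha', Complex.exp_ofReal_mul_I_re, hα, cos_arccos (abs_le.1 ht).1 (abs_le.1 ht).2]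
  have hconj : conj a = Complex.exp ((-α : ℝ) * Complex.I) := by
    rw [ha', ← Complex.exp_conj]; simp
  have e := zonComb_eq_kap hl h0 h1 ha B k
  rw [hre] at e
  rw [← Real.norm_eq_abs, ← Complex.norm_real, e, kap, norm_mul]
  have hpi : ‖(2 * π : ℂ)⁻¹‖ = (2 * π)⁻¹ := by
    rw [norm_inv, norm_mul, Complex.norm_real, Real.norm_of_nonneg pi_pos.le]; simp
  rw [hpi]
  gcongr
  have hX := continuous_norm_rpow h0 h1 α (-(lam + 1))
  have hY := continuous_norm_rpow h0 h1 (-α) (-(lam + 1))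
  refine (intervalIntegral.norm_integral_le_of_norm_le (by positivity)
    (g := fun ψ => (ρ⁻¹) ^ k * (H * (2 ^ (lam + 1) *
      (‖1 - Complex.exp (α * Complex.I) * circleMap 0 ρ ψ‖ ^ (-(lam + 1)) +
        ‖1 - Complex.exp ((-α : ℝ) * Complex.I) * circleMap 0 ρ ψ‖ ^ (-(lam + 1))))))
    (Filter.Eventually.of_forall fun ψ _ => ?_)
    (Continuous.intervalIntegrable (by fun_prop) _ _)).trans ?_
  · have hz := circleMap_mem_ball_one h0 h1 ψ
    have hzn : ‖circleMap 0 ρ ψ‖ = ρ := by rw [norm_circleMap_zero, abs_of_pos h0]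
    have hP := norm_poisF_mul_le hl ha hz
    rw [hconj] at hP
    have hBz := hB _ hzn
    rw [norm_mul, norm_pow, norm_inv, hzn, mul_comm, norm_mul]
    refine mul_le_mul_of_nonneg_left ((mul_le_mul_of_nonneg_right hBz (norm_nonneg _)).trans ?_)
      (by positivity)
    rw [mul_assoc]
    exact mul_le_mul_of_nonneg_left hP hH
  · rw [intervalIntegral.integral_const_mul, intervalIntegral.integral_const_mul,
      intervalIntegral.integral_const_mul, intervalIntegral.integral_add
        (hX.intervalIntegrable _ _) (hY.intervalIntegrable _ _), two_mul (2 * _ / _ * _)]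
    have := integral_norm_rpow_le hl h2 h1 α
    have := integral_norm_rpow_le hl h2 h1 (-α)
    gcongr

lemma inv_one_sub_pow_le {n k : ℕ} (hn : 1 ≤ n) (hk : k ≤ n) :
    ((1 - 1 / (2 * (n : ℝ)))⁻¹) ^ k ≤ 2 := by
  have hn' : (1 : ℝ) ≤ n := by exact_mod_cast hn
  have hx : 1 / (2 * (n : ℝ)) ≤ 1 / 2 := by gcongr; linarith
  have hpos : 0 < 1 - 1 / (2 * (n : ℝ)) := by linarith
  have hx0 : 0 < 1 / (2 * (n : ℝ)) := by positivity
  have hb := one_add_mul_le_pow (a := -(1 / (2 * (n : ℝ)))) (by linarith) k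
  have hkn : (k : ℝ) * (1 / (2 * (n : ℝ))) ≤ 1 / 2 := by
    have : (k : ℝ) ≤ n := by exact_mod_cast hk
    calc (k : ℝ) * (1 / (2 * (n : ℝ))) ≤ n * (1 / (2 * (n : ℝ))) := by gcongr
      _ = 1 / 2 := by field_simp
  rw [inv_pow, inv_le_comm₀ (by positivity) (by norm_num)]
  rw [← sub_eq_add_neg] at hb
  linarith

/-- Bound for combinations of zonal polynomials of degree at most `n` whose symbol vanishes to
order `lam` at `±1`. -/
lemma exists_abs_zonComb_le {lam : ℝ} (hl : 0 < lam) :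
    ∃ C : ℝ, 0 < C ∧ ∀ n : ℕ, 1 ≤ n → ∀ k ≤ n, ∀ H : ℝ, 0 ≤ H → ∀ B : Polynomial ℝ,
      (∀ z : ℂ, ‖z‖ = 1 - 1 / (2 * (n : ℝ)) →
        ‖Polynomial.aeval (z ^ 2) B‖ ≤ H * ‖1 - z ^ 2‖ ^ lam) →
      ∀ t : ℝ, |t| ≤ 1 → |zonComb lam B k t| ≤ C * H * (n : ℝ) ^ lam := by
  refine ⟨(2 * π)⁻¹ * (2 * (2 ^ (lam + 1) * (2 * (2 * π ^ (lam + 1) / lam * 2 ^ lam)))),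
    by positivity, fun n hn k hk H hH B hB t ht => ?_⟩
  have hn' : (1 : ℝ) ≤ n := by exact_mod_cast hn
  have hx : 1 / (2 * (n : ℝ)) ≤ 1 / 2 := by gcongr; linarith
  have hx0 : 0 < 1 / (2 * (n : ℝ)) := by positivity
  refine (abs_zonComb_le_of_radius hl (by linarith) (by linarith) hH B hB k ht).trans ?_
  have e : (1 - (1 - 1 / (2 * (n : ℝ)))) ^ (-lam) = 2 ^ lam * (n : ℝ) ^ lam := by
    rw [sub_sub_cancel, one_div, inv_rpow (by positivity), rpow_neg (by positivity), inv_inv,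
      mul_rpow (by norm_num) (by positivity)]
  rw [e]
  calc _ ≤ (2 * π)⁻¹ * (2 * (H * (2 ^ (lam + 1) *
        (2 * (2 * π ^ (lam + 1) / lam * (2 ^ lam * (n : ℝ) ^ lam)))))) := by
        gcongr; exact inv_one_sub_pow_le hn hk
    _ = _ := by ring

end KernelBound

section Multiplier

open Polynomial Finset

/-- The average of the powers `X, X ^ 2, …, X ^ M`. -/
def avgPow (M : ℕ) : ℝ[X] := C (M : ℝ)⁻¹ * ∑ i ∈ range M, X ^ (i + 1)

variable {M : ℕ}

lemma natDegree_one_sub_avgPow_pow_le (m : ℕ) : ((1 - avgPow M) ^ m).natDegree ≤ m * M := by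
  have h : (avgPow M).natDegree ≤ M := by
    refine (natDegree_C_mul_le _ _).trans (natDegree_sum_le_of_forall_le _ _ fun i hi => ?_)
    rw [natDegree_X_pow]
    have := mem_range.1 hi
    omega
  refine natDegree_pow_le.trans (Nat.mul_le_mul_left _ ?_)
  refine (natDegree_sub_le _ _).trans ?_
  simpa using h

lemma abs_coeff_avgPow_mul_le (hM : 1 ≤ M) {b : ℝ} (hb : 0 ≤ b) {V : ℝ[X]}
    (hV : ∀ j, |V.coeff j| ≤ b) (j : ℕ) : |(avgPow M * V).coeff j| ≤ b := by
  have hM' : (0 : ℝ) < M := by exact_mod_cast hM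
  rw [avgPow, mul_assoc, coeff_C_mul, sum_mul, finsetSum_coeff, abs_mul,
    abs_of_pos (inv_pos.2 hM'), inv_mul_le_iff₀ hM']
  refine (abs_sum_le_sum_abs _ _).trans ((sum_le_sum (g := fun _ => b) fun i _ => ?_).trans ?_)
  · rw [coeff_X_pow_mul']
    split_ifs
    · exact hV _
    · simpa using hb
  · simp

lemma abs_coeff_avgPow_le (hM : 1 ≤ M) (j : ℕ) : |(avgPow M).coeff j| ≤ (M : ℝ)⁻¹ := by
  have hM' : (0 : ℝ) < M := by exact_mod_cast hM
  rw [avgPow, coeff_C_mul, finsetSum_coeff, abs_mul, abs_of_pos (inv_pos.2 hM')]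
  refine mul_le_of_le_one_right (by positivity) ?_
  simp only [coeff_X_pow]
  cases j with
  | zero => simp
  | succ j =>
    simp only [add_left_inj, sum_ite_eq]
    split_ifs <;> simp

lemma coeff_zero_avgPow : (avgPow M).coeff 0 = 0 := by
  simp [avgPow]

lemma coeff_zero_one_sub_avgPow_pow (m : ℕ) : ((1 - avgPow M) ^ m).coeff 0 = 1 := by
  rw [coeff_zero_eq_eval_zero, eval_pow, eval_sub, ← coeff_zero_eq_eval_zero (avgPow M),
    coeff_zero_avgPow]
  simp

lemma abs_coeff_one_sub_avgPow_pow_le (hM : 1 ≤ M) (m : ℕ) {j : ℕ} (hj : 1 ≤ j) :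
    |((1 - avgPow M) ^ m).coeff j| ≤ 2 ^ m / M := by
  have hM' : (0 : ℝ) < M := by exact_mod_cast hM
  have key : ∀ j, |(1 - (1 - avgPow M) ^ m).coeff j| ≤ (2 ^ m - 1) * (M : ℝ)⁻¹ := by
    induction m with
    | zero => simp
    | succ m ih =>
      intro j
      have hb : (0 : ℝ) ≤ (2 ^ m - 1) * (M : ℝ)⁻¹ :=
        mul_nonneg (sub_nonneg.2 (one_le_pow₀ (by norm_num))) (by positivity)
      have e : (1 - (1 - avgPow M) ^ (m + 1)) = (1 - (1 - avgPow M) ^ m) + avgPow M -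
          avgPow M * (1 - (1 - avgPow M) ^ m) := by ring
      rw [e, coeff_sub, coeff_add]
      have h1 := ih j
      have h2 := abs_coeff_avgPow_le hM j
      have h3 := abs_coeff_avgPow_mul_le hM hb ih j
      rw [abs_le] at *
      rw [pow_succ]
      constructor <;> linarith
  have h := key j
  rw [coeff_sub, coeff_one, if_neg (by omega), zero_sub, abs_neg] at h
  refine h.trans ?_
  rw [div_eq_mul_inv]
  gcongr
  linarith

lemma norm_aeval_one_sub_avgPow_pow_le (hM : 1 ≤ M) {lam : ℝ} (hl : 0 < lam) {m : ℕ}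
    (hm : lam ≤ m) {w : ℂ} (hw : ‖w‖ ≤ 1) :
    ‖aeval w ((1 - avgPow M) ^ m)‖ ≤ 2 ^ m * (M : ℝ) ^ lam * ‖1 - w‖ ^ lam := by
  have hM' : (0 : ℝ) < M := by exact_mod_cast hM
  have hMC : (M : ℂ) ≠ 0 := by exact_mod_cast hM'.ne'
  have e : aeval w (1 - avgPow M) = (M : ℂ)⁻¹ * ∑ i ∈ range M, (1 - w ^ (i + 1)) := by
    simp [avgPow, sum_sub_distrib, mul_sub, hMC]
  have hs : ∀ b : ℝ, (∀ i < M, ‖1 - w ^ (i + 1)‖ ≤ b) → ‖aeval w (1 - avgPow M)‖ ≤ b := by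
    intro b hb
    rw [e, norm_mul, norm_inv, Complex.norm_natCast, inv_mul_le_iff₀ hM']
    refine (norm_sum_le _ _).trans
      ((sum_le_sum (g := fun _ => b) fun i hi => hb i (mem_range.1 hi)).trans ?_)
    simp
  have h1 : ‖aeval w (1 - avgPow M)‖ ≤ 2 := by
    refine hs 2 fun i _ => (norm_sub_le _ _).trans ?_
    rw [norm_pow, norm_one]
    have := pow_le_one₀ (n := i + 1) (norm_nonneg w) hw
    linarith
  have h2 : ‖aeval w (1 - avgPow M)‖ ≤ M * ‖1 - w‖ := by
    refine hs _ fun i hi => ?_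
    have e2 : 1 - w ^ (i + 1) = (∑ l ∈ range (i + 1), w ^ l) * (1 - w) :=
      (geom_sum_mul_neg w (i + 1)).symm
    rw [e2, norm_mul]
    gcongr
    refine (norm_sum_le _ _).trans
      ((sum_le_sum (g := fun _ => (1 : ℝ)) fun l _ => ?_).trans ?_)
    · rw [norm_pow]; exact pow_le_one₀ (norm_nonneg w) hw
    · simp only [sum_const, card_range, nsmul_eq_mul, mul_one]
      exact_mod_cast hi
  rw [map_pow, norm_pow]
  have h0 := norm_nonneg (aeval w (1 - avgPow M))
  generalize ‖aeval w (1 - avgPow M)‖ = x at *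
  rcases h0.eq_or_lt with rfl | hx
  · rcases Nat.eq_zero_or_pos m with rfl | hm0
    · exact absurd hm (by simpa using hl)
    · rw [zero_pow hm0.ne']
      positivity
  calc x ^ m = 2 ^ m * (x / 2) ^ (m : ℝ) := by
        rw [Real.rpow_natCast, div_pow]; field_simp
    _ ≤ 2 ^ m * (x / 2) ^ lam := by
        gcongr 2 ^ m * ?_
        exact Real.rpow_le_rpow_of_exponent_ge (by positivity) (by linarith) hm
    _ ≤ 2 ^ m * (M * ‖1 - w‖) ^ lam := by
        gcongr
        linarith
    _ = _ := by rw [Real.mul_rpow hM'.le (norm_nonneg _)]; ring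

end Multiplier

section KernelBound

/-- Combining the degrees `k, k - 2, …` yields a kernel smaller than the zonal one. -/
lemma exists_abs_zonComb_avgPow_le {lam : ℝ} (hl : 0 < lam) {m : ℕ} (hm : lam ≤ m) :
    ∃ C : ℝ, 0 < C ∧ ∀ n : ℕ, 1 ≤ n → ∀ k ≤ n, ∀ M : ℕ, 1 ≤ M → ∀ t : ℝ, |t| ≤ 1 →
      |zonComb lam ((1 - avgPow M) ^ m) k t| ≤ C * (M : ℝ) ^ lam * (n : ℝ) ^ lam := by
  obtain ⟨C, hC, h⟩ := exists_abs_zonComb_le hl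
  refine ⟨C * 2 ^ m, by positivity, fun n hn k hk M hM t ht => ?_⟩
  refine (h n hn k hk (2 ^ m * (M : ℝ) ^ lam) (by positivity) _ (fun z hz => ?_) t ht).trans
    (le_of_eq (by ring))
  refine norm_aeval_one_sub_avgPow_pow_le hM hl hm ?_
  rw [norm_pow]
  refine pow_le_one₀ (norm_nonneg z) ?_
  rw [hz]
  have : (0 : ℝ) ≤ 1 / (2 * (n : ℝ)) := by positivity
  linarith

lemma exists_abs_zonComb_one_le {lam : ℝ} (hl : 0 < lam) :
    ∃ C : ℝ, 0 < C ∧ ∀ n : ℕ, 1 ≤ n → ∀ t : ℝ, |t| ≤ 1 →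
      |zonComb lam 1 n t| ≤ C * (n : ℝ) ^ (2 * lam) := by
  obtain ⟨C, hC, h⟩ := exists_abs_zonComb_le hl
  refine ⟨C * 2 ^ lam, by positivity, fun n hn t ht => ?_⟩
  have hn' : (0 : ℝ) < n := by exact_mod_cast hn
  refine (h n hn n le_rfl ((2 * (n : ℝ)) ^ lam) (by positivity) 1 (fun z hz => ?_) t ht).trans
    (le_of_eq ?_)
  · rw [map_one, norm_one, ← Real.mul_rpow (by positivity) (norm_nonneg _)]
    refine Real.one_le_rpow ?_ hl.le
    have h1 : 1 - ‖z ^ 2‖ ≤ ‖1 - z ^ 2‖ := by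
      have := norm_sub_norm_le (1 : ℂ) (z ^ 2)
      rwa [norm_one] at this
    have h0 : 0 ≤ ‖z‖ := norm_nonneg z
    have h3 : 0 ≤ 1 / (2 * (n : ℝ)) := by positivity
    have h2 : ‖z ^ 2‖ ≤ ‖z‖ := by
      rw [norm_pow, pow_two]
      exact mul_le_of_le_one_right h0 (by linarith)
    calc (1 : ℝ) = 2 * n * (1 / (2 * (n : ℝ))) := by field_simp
      _ ≤ 2 * n * ‖1 - z ^ 2‖ := by gcongr; linarith
  · rw [Real.mul_rpow (by norm_num) hn'.le, two_mul lam, Real.rpow_add hn']; ring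

end KernelBound

section OperatorBounds

open Finset

variable {d : ℕ}

lemma continuous_geg (lam : ℝ) (k : ℕ) : Continuous fun t : ℝ => geg lam t (1 : ℝ) k := by
  induction k using Nat.twoStepInduction with
  | zero => simp only [geg]; fun_prop
  | one => simp only [geg]; fun_prop
  | more k ih1 ih2 => simp only [geg]; fun_prop

lemma continuous_zon (lam : ℝ) (k : ℕ) : Continuous (zon lam k) :=
  continuous_const.mul (continuous_geg lam k)

lemma integrable_zon_mul (lam : ℝ) (k : ℕ) (x : Sph d) (f : Lp ℝ 2 (sphMeasure d)) :
    Integrable (fun y : Sph d =>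
      zon lam k (inner ℝ (x : EuclideanSpace ℝ (Fin d)) y) * f y) (sphMeasure d) := by
  have hc : Continuous fun y : Sph d => zon lam k (inner ℝ (x : EuclideanSpace ℝ (Fin d)) y) :=
    (continuous_zon lam k).comp (by fun_prop)
  obtain ⟨b, hb⟩ := isCompact_univ.exists_bound_of_continuousOn hc.continuousOn
  exact ((Lp.memLp f).integrable (by norm_num)).bdd_mul hc.aestronglyMeasurable
    (Filter.Eventually.of_forall fun y => hb y (Set.mem_univ y))

lemma integral_zonComb_mul (lam : ℝ) (B : Polynomial ℝ) (k : ℕ) (x : Sph d)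
    (f : Lp ℝ 2 (sphMeasure d)) :
    ∫ y : Sph d, zonComb lam B k (inner ℝ (x : EuclideanSpace ℝ (Fin d)) y) * f y
      ∂(sphMeasure d) = ∑ j ∈ range (B.natDegree + 1), B.coeff j * if 2 * j ≤ k then
        ∫ y : Sph d, zon lam (k - 2 * j) (inner ℝ (x : EuclideanSpace ℝ (Fin d)) y) * f y
          ∂(sphMeasure d) else 0 := by
  simp only [zonComb, sum_mul]
  rw [integral_finsetSum]
  · refine sum_congr rfl fun j _ => ?_
    split_ifs with h
    · simp only [mul_assoc]; rw [integral_const_mul]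
    · simp
  · intro j _
    split_ifs with h
    · simp only [mul_assoc]; exact (integrable_zon_mul lam _ x f).const_mul _
    · simp

lemma abs_sum_coeff_mul_inner_proj_le (hd : 3 ≤ d) {lam : ℝ} (hlam : (d : ℝ) = 2 * lam + 2)
    {proj : ℕ → Lp ℝ 2 (sphMeasure d) → Lp ℝ 2 (sphMeasure d)}
    (hproj : ∀ k, IsOrthProjOnto d k (proj k)) (B : Polynomial ℝ) (k : ℕ) {K : ℝ}
    (hK : ∀ t : ℝ, |t| ≤ 1 → |zonComb lam B k t| ≤ K) (f g : Lp ℝ 2 (sphMeasure d)) :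
    |∑ j ∈ range (B.natDegree + 1), B.coeff j *
      if 2 * j ≤ k then inner ℝ (proj (k - 2 * j) f) g else 0| ≤
      ((sphMeasure d).real Set.univ)⁻¹ * K * (∫ x, |f x| ∂(sphMeasure d)) *
        ∫ x, |g x| ∂(sphMeasure d) := by
  set S := (sphMeasure d).real Set.univ with hS
  have hS0 : 0 < S := sphMeasure_real_univ_pos hd
  set u : Lp ℝ 2 (sphMeasure d) := ∑ j ∈ range (B.natDegree + 1), B.coeff j •
    if 2 * j ≤ k then proj (k - 2 * j) f else 0 with hu
  have e1 : ∑ j ∈ range (B.natDegree + 1), B.coeff j *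
      (if 2 * j ≤ k then inner ℝ (proj (k - 2 * j) f) g else 0) = inner ℝ u g := by
    rw [hu, sum_inner]
    refine sum_congr rfl fun j _ => ?_
    rw [real_inner_smul_left]
    split_ifs <;> simp
  have e2 : u =ᵐ[sphMeasure d] fun x => S⁻¹ *
      ∫ y : Sph d, zonComb lam B k (inner ℝ (x : EuclideanSpace ℝ (Fin d)) y) * f y
        ∂(sphMeasure d) := by
    have h1 : ∀ j, (if 2 * j ≤ k then proj (k - 2 * j) f else 0 : Lp ℝ 2 (sphMeasure d))
        =ᵐ[sphMeasure d] fun x => S⁻¹ * if 2 * j ≤ k then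
          ∫ y : Sph d, zon lam (k - 2 * j) (inner ℝ (x : EuclideanSpace ℝ (Fin d)) y) * f y
            ∂(sphMeasure d) else 0 := by
      intro j
      split_ifs with h
      · exact proj_ae_eq hd hlam (hproj _) f
      · simp only [mul_zero]; exact Lp.coeFn_zero ℝ 2 (sphMeasure d)
    have h2 : ∀ s : Finset ℕ, (∑ j ∈ s, B.coeff j •
        (if 2 * j ≤ k then proj (k - 2 * j) f else 0) : Lp ℝ 2 (sphMeasure d))
        =ᵐ[sphMeasure d] fun x => S⁻¹ * ∑ j ∈ s, B.coeff j * if 2 * j ≤ k then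
          ∫ y : Sph d, zon lam (k - 2 * j) (inner ℝ (x : EuclideanSpace ℝ (Fin d)) y) * f y
            ∂(sphMeasure d) else 0 := by
      intro s
      induction s using Finset.induction_on with
      | empty => simp only [sum_empty, mul_zero]; exact Lp.coeFn_zero ℝ 2 (sphMeasure d)
      | insert j s hj ih =>
        simp only [sum_insert hj]
        filter_upwards [Lp.coeFn_add (B.coeff j •
          (if 2 * j ≤ k then proj (k - 2 * j) f else 0 : Lp ℝ 2 (sphMeasure d)))
          (∑ j ∈ s, B.coeff j • (if 2 * j ≤ k then proj (k - 2 * j) f else 0)), ih, h1 j,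
          Lp.coeFn_smul (B.coeff j)
            (if 2 * j ≤ k then proj (k - 2 * j) f else 0 : Lp ℝ 2 (sphMeasure d))]
          with x hx1 hx2 hx3 hx4
        rw [hx1, Pi.add_apply, hx2, hx4, Pi.smul_apply, hx3, smul_eq_mul]
        ring
    filter_upwards [h2 (range (B.natDegree + 1))] with x hx
    rw [hx, integral_zonComb_mul]
  have hfi : Integrable (fun y => |f y|) (sphMeasure d) :=
    ((Lp.memLp f).integrable (by norm_num)).abs
  have hgi : Integrable (fun y => |g y|) (sphMeasure d) :=
    ((Lp.memLp g).integrable (by norm_num)).abs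
  have e3 : ∀ᵐ x ∂(sphMeasure d), |u x| ≤ S⁻¹ * K * ∫ y, |f y| ∂(sphMeasure d) := by
    filter_upwards [e2] with x hx
    rw [hx, abs_mul, abs_of_pos (inv_pos.2 hS0), mul_assoc]
    gcongr
    rw [← Real.norm_eq_abs]
    refine (norm_integral_le_of_norm_le (hfi.const_mul K)
      (Filter.Eventually.of_forall fun y => ?_)).trans_eq (integral_const_mul _ _)
    rw [norm_mul, Real.norm_eq_abs, Real.norm_eq_abs]
    exact mul_le_mul_of_nonneg_right (hK _ (abs_inner_le_one x y)) (abs_nonneg _)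
  rw [e1, L2.inner_def, ← Real.norm_eq_abs]
  refine (norm_integral_le_of_norm_le (hgi.const_mul _) ?_).trans_eq (integral_const_mul _ _)
  filter_upwards [e3] with x hx
  rw [real_inner_comm, RCLike.inner_apply, conj_trivial, norm_mul, Real.norm_eq_abs,
    Real.norm_eq_abs]
  exact mul_le_mul_of_nonneg_right hx (abs_nonneg _)

/-- The basic `L¹` bound for matrix coefficients of the projections. -/
lemma exists_abs_inner_proj_le (hd : 3 ≤ d) {lam : ℝ} (hlam : (d : ℝ) = 2 * lam + 2)
    (hl : 0 < lam) {proj : ℕ → Lp ℝ 2 (sphMeasure d) → Lp ℝ 2 (sphMeasure d)}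
    (hproj : ∀ k, IsOrthProjOnto d k (proj k)) :
    ∃ C : ℝ, 0 < C ∧ ∀ n : ℕ, 1 ≤ n → ∀ f g : Lp ℝ 2 (sphMeasure d),
      |inner ℝ (proj n f) g| ≤ C * (n : ℝ) ^ (2 * lam) *
        ((∫ x, |f x| ∂(sphMeasure d)) * ∫ x, |g x| ∂(sphMeasure d)) := by
  obtain ⟨C, hC, h⟩ := exists_abs_zonComb_one_le hl
  have hS0 : 0 < (sphMeasure d).real Set.univ := sphMeasure_real_univ_pos hd
  refine ⟨((sphMeasure d).real Set.univ)⁻¹ * C, by positivity, fun n hn f g => ?_⟩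
  have := abs_sum_coeff_mul_inner_proj_le hd hlam hproj 1 n (h n hn) f g
  simp only [Polynomial.natDegree_one, zero_add, range_one, sum_singleton,
    Polynomial.coeff_one_zero, mul_zero, zero_le, if_true, one_mul, Nat.sub_zero] at this
  exact this.trans_eq (by ring)

lemma exists_abs_inner_proj_le_sum (hd : 3 ≤ d) {lam : ℝ} (hlam : (d : ℝ) = 2 * lam + 2)
    (hl : 0 < lam) {proj : ℕ → Lp ℝ 2 (sphMeasure d) → Lp ℝ 2 (sphMeasure d)}
    (hproj : ∀ k, IsOrthProjOnto d k (proj k)) :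
    ∃ C : ℝ, 0 < C ∧ ∀ n : ℕ, 1 ≤ n → ∀ k ≤ n, ∀ M : ℕ, 1 ≤ M →
      ∃ s : Finset ℕ, (s.card : ℝ) ≤ C * M ∧ (∀ l ∈ s, l ≤ k) ∧
        ∀ f g : Lp ℝ 2 (sphMeasure d),
      |inner ℝ (proj k f) g| ≤ C / M * ∑ l ∈ s, |inner ℝ (proj l f) g| +
        C * (M : ℝ) ^ lam * (n : ℝ) ^ lam *
        ((∫ x, |f x| ∂(sphMeasure d)) * ∫ x, |g x| ∂(sphMeasure d)) := by
  have hm : lam ≤ d := by linarith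
  obtain ⟨C, hC, h⟩ := exists_abs_zonComb_avgPow_le hl hm
  have hS0 : 0 < (sphMeasure d).real Set.univ := sphMeasure_real_univ_pos hd
  have hd0 : (0 : ℝ) < d := by linarith
  set C' := max ((2 : ℝ) ^ d) (max d (((sphMeasure d).real Set.univ)⁻¹ * C)) with hC'
  have h1 : (2 : ℝ) ^ d ≤ C' := le_max_left _ _
  have h2 : (d : ℝ) ≤ C' := (le_max_left _ _).trans (le_max_right _ _)
  have h3 : ((sphMeasure d).real Set.univ)⁻¹ * C ≤ C' :=
    (le_max_right _ _).trans (le_max_right _ _)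
  refine ⟨C', hd0.trans_le h2, fun n hn k hk M hM => ?_⟩
  set t := (Icc 1 (d * M)).filter (fun j => 2 * j ≤ k) with ht
  have hinj : Set.InjOn (fun j => k - 2 * j) (t : Set ℕ) := by
    intro i hi j hj hij
    simp only [ht, coe_filter, Set.mem_ofPred_eq] at hi hj hij
    omega
  refine ⟨t.image fun j => k - 2 * j, ?_, ?_, fun f g => ?_⟩
  · calc ((t.image fun j => k - 2 * j).card : ℝ) ≤ ((d * M : ℕ) : ℝ) := by
          exact_mod_cast card_image_le.trans ((card_filter_le _ _).trans (by simp))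
      _ ≤ C' * M := by push_cast; gcongr
  · intro l hl
    obtain ⟨j, -, rfl⟩ := mem_image.1 hl
    omega
  rw [sum_image hinj]
  set B := (1 - avgPow M) ^ d with hB
  have hb := abs_sum_coeff_mul_inner_proj_le hd hlam hproj B k (h n hn k hk M hM) f g
  have hf0 : 0 ≤ ∫ x, |f x| ∂(sphMeasure d) := integral_nonneg fun _ => abs_nonneg _
  have hg0 : 0 ≤ ∫ x, |g x| ∂(sphMeasure d) := integral_nonneg fun _ => abs_nonneg _
  rw [sum_range_succ', coeff_zero_one_sub_avgPow_pow] at hb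
  simp only [mul_zero, zero_le, if_true, one_mul, Nat.sub_zero] at hb
  set R := ∑ j ∈ range B.natDegree, B.coeff (j + 1) *
    (if 2 * (j + 1) ≤ k then inner ℝ (proj (k - 2 * (j + 1)) f) g else 0) with hR
  have hRb : |R| ≤ C' / M * ∑ j ∈ t, |inner ℝ (proj (k - 2 * j) f) g| := by
    have hM' : (0 : ℝ) < M := by exact_mod_cast hM
    have hq : 0 ≤ C' / M := by positivity
    calc |R| ≤ ∑ j ∈ range B.natDegree, C' / M *
          |if 2 * (j + 1) ≤ k then inner ℝ (proj (k - 2 * (j + 1)) f) g else 0| := by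
          refine (abs_sum_le_sum_abs _ _).trans (sum_le_sum fun j _ => ?_)
          rw [abs_mul]
          gcongr
          exact (abs_coeff_one_sub_avgPow_pow_le hM d (by omega)).trans (by gcongr)
      _ ≤ ∑ j ∈ range (d * M), C' / M *
          |if 2 * (j + 1) ≤ k then inner ℝ (proj (k - 2 * (j + 1)) f) g else 0| :=
          sum_le_sum_of_subset_of_nonneg
            (range_mono (natDegree_one_sub_avgPow_pow_le d)) fun j _ _ => by positivity
      _ = _ := by
          rw [← mul_sum, ht, sum_filter, range_eq_Ico,
            sum_Ico_add' (fun j => |if 2 * j ≤ k then inner ℝ (proj (k - 2 * j) f) g else 0|)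
              0 (d * M) 1]
          congr 1
          refine sum_congr (by ext; simp) fun j _ => ?_
          split_ifs <;> simp
  calc |inner ℝ (proj k f) g| = |(R + inner ℝ (proj k f) g) - R| := by rw [add_sub_cancel_left]
    _ ≤ |R| + |R + inner ℝ (proj k f) g| := (abs_sub _ _).trans_eq (add_comm _ _)
    _ ≤ _ := by
      refine add_le_add hRb (hb.trans ?_)
      calc _ = ((sphMeasure d).real Set.univ)⁻¹ * C * ((M : ℝ) ^ lam * (n : ℝ) ^ lam *
            ((∫ x, |f x| ∂(sphMeasure d)) * ∫ x, |g x| ∂(sphMeasure d))) := by ring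
        _ ≤ C' * ((M : ℝ) ^ lam * (n : ℝ) ^ lam *
            ((∫ x, |f x| ∂(sphMeasure d)) * ∫ x, |g x| ∂(sphMeasure d))) := by gcongr
        _ = _ := by ring

end OperatorBounds

section RestrictedBounds

open Finset Real

variable {d : ℕ} {lam : ℝ} {proj : ℕ → Lp ℝ 2 (sphMeasure d) → Lp ℝ 2 (sphMeasure d)}

/-- `f` satisfies the `L¹` and `L²` bounds of a function bounded by one and supported on a set of
measure `e`. -/
def BumpBound (f : Lp ℝ 2 (sphMeasure d)) (e : ℝ) : Prop :=
  0 < e ∧ ‖f‖ ^ 2 ≤ e ∧ ∫ x, |f x| ∂(sphMeasure d) ≤ e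

lemma exists_nat_inv_le {r : ℝ} (h0 : 0 < r) (h1 : r < 1) :
    ∃ M : ℕ, 1 ≤ M ∧ (M : ℝ)⁻¹ ≤ r ∧ (M : ℝ) ≤ 2 * r⁻¹ := by
  have h2 : 1 < r⁻¹ := (one_lt_inv₀ h0).2 h1
  refine ⟨⌈r⁻¹⌉₊, Nat.one_le_ceil_iff.2 (by positivity), ?_, ?_⟩
  · exact inv_le_of_inv_le₀ h0 (Nat.le_ceil _)
  · have := Nat.ceil_lt_add_one (a := r⁻¹) (by positivity)
    linarith

lemma exists_norm_proj_sq_le_of_bump (hd : 3 ≤ d) (hlam : (d : ℝ) = 2 * lam + 2) (hl : 0 < lam)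
    (hproj : ∀ k, IsOrthProjOnto d k (proj k)) :
    ∃ C : ℝ, 0 < C ∧ ∀ n : ℕ, 1 ≤ n → ∀ k ≤ n, ∀ f e, BumpBound f e → ∀ r : ℝ, 0 < r →
      ‖proj k f‖ ^ 2 ≤ C * (r * e + (n : ℝ) ^ lam * r ^ (-lam) * (e * e)) := by
  obtain ⟨C, hC, h⟩ := exists_abs_inner_proj_le_sum hd hlam hl hproj
  refine ⟨1 + C * 2 ^ lam + C, by positivity, fun n hn k hk f e ⟨he, hf2, hf1⟩ r hr => ?_⟩
  rcases le_or_gt 1 r with h1 | h1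
  · calc ‖proj k f‖ ^ 2 ≤ ‖f‖ ^ 2 := by gcongr; exact proj_norm_le (hproj k) f
      _ ≤ 1 * (1 * e + 0) := by linarith
      _ ≤ _ := by
        gcongr
        · have : 0 ≤ C * 2 ^ lam + C := by positivity
          linarith
        · positivity
  · obtain ⟨M, hM, hM1, hM2⟩ := exists_nat_inv_le hr h1
    obtain ⟨s, -, -, hs⟩ := h n hn k hk M hM
    have hsum : ∑ l ∈ s, |inner ℝ (proj l f) f| ≤ e := by
      refine le_trans (le_of_eq (sum_congr rfl fun l _ => ?_)) ((proj_bessel hd hproj s f).trans hf2)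
      rw [← proj_norm_sq (hproj l), abs_of_nonneg (sq_nonneg _)]
    have hf0 : 0 ≤ ∫ x, |f x| ∂(sphMeasure d) := integral_nonneg fun _ => abs_nonneg _
    rw [proj_norm_sq (hproj k)]
    calc inner ℝ (proj k f) f ≤ C / M * e + C * (M : ℝ) ^ lam * (n : ℝ) ^ lam * (e * e) :=
          (le_abs_self _).trans ((hs f f).trans (by gcongr))
      _ ≤ C * r * e + C * (2 * r⁻¹) ^ lam * (n : ℝ) ^ lam * (e * e) := by
          rw [div_eq_mul_inv]; gcongr
      _ = C * (r * e) + C * 2 ^ lam * ((n : ℝ) ^ lam * r ^ (-lam) * (e * e)) := by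
          rw [mul_rpow (by norm_num) (by positivity), inv_rpow hr.le, rpow_neg hr.le]; ring
      _ ≤ (1 + C * 2 ^ lam + C) * (r * e) +
          (1 + C * 2 ^ lam + C) * ((n : ℝ) ^ lam * r ^ (-lam) * (e * e)) := by
          have : 0 ≤ C * 2 ^ lam := by positivity
          gcongr <;> linarith
      _ = _ := by ring

lemma exists_norm_proj_sq_le_of_bump' (hd : 3 ≤ d) (hlam : (d : ℝ) = 2 * lam + 2) (hl : 0 < lam)
    (hproj : ∀ k, IsOrthProjOnto d k (proj k)) :
    ∃ C : ℝ, 0 < C ∧ ∀ n : ℕ, 1 ≤ n → ∀ k ≤ n, ∀ f e, BumpBound f e →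
      ‖proj k f‖ ^ 2 ≤ C * (((n : ℝ) ^ lam * e) ^ (1 / (1 + lam)) * e) := by
  obtain ⟨C, hC, h⟩ := exists_norm_proj_sq_le_of_bump hd hlam hl hproj
  refine ⟨2 * C, by positivity, fun n hn k hk f e hf => ?_⟩
  have he := hf.1
  have hn' : (0 : ℝ) < n := by exact_mod_cast hn
  have hν : 0 < (n : ℝ) ^ lam * e := by positivity
  refine (h n hn k hk f e hf (((n : ℝ) ^ lam * e) ^ (1 / (1 + lam))) (by positivity)).trans
    (le_of_eq ?_)
  have e1 : ((n : ℝ) ^ lam * e) * (((n : ℝ) ^ lam * e) ^ (1 / (1 + lam))) ^ (-lam) =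
      ((n : ℝ) ^ lam * e) ^ (1 / (1 + lam)) := by
    rw [← rpow_mul hν.le]
    nth_rewrite 1 [← rpow_one ((n : ℝ) ^ lam * e)]
    rw [← rpow_add hν]
    congr 1
    field_simp; ring
  calc _ = C * (((n : ℝ) ^ lam * e) ^ (1 / (1 + lam)) * e + (((n : ℝ) ^ lam * e) *
        (((n : ℝ) ^ lam * e) ^ (1 / (1 + lam))) ^ (-lam)) * e) := by ring
    _ = _ := by rw [e1]; ring

lemma exists_abs_inner_proj_le_of_bump (hd : 3 ≤ d) (hlam : (d : ℝ) = 2 * lam + 2) (hl : 0 < lam)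
    (hproj : ∀ k, IsOrthProjOnto d k (proj k)) :
    ∃ C : ℝ, 0 < C ∧ ∀ n : ℕ, 1 ≤ n → ∀ f e, BumpBound f e → ∀ g e', BumpBound g e' →
      ∀ r : ℝ, 0 < r → |inner ℝ (proj n f) g| ≤
        C * (√(r * e * (((n : ℝ) ^ lam * e') ^ (1 / (1 + lam)) * e')) +
          (n : ℝ) ^ lam * r ^ (-lam) * (e * e')) := by
  obtain ⟨C, hC, h⟩ := exists_abs_inner_proj_le_sum hd hlam hl hproj
  obtain ⟨C1, hC1, h1⟩ := exists_norm_proj_sq_le_of_bump' hd hlam hl hproj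
  refine ⟨√C1 + C * √(C * C1) + C * 2 ^ lam, by positivity,
    fun n hn f e ⟨he, hf2, hf1⟩ g e' hg r hr => ?_⟩
  set G := ((n : ℝ) ^ lam * e') ^ (1 / (1 + lam)) * e' with hG
  have he' := hg.1
  have hn' : (0 : ℝ) < n := by exact_mod_cast hn
  have hG0 : 0 < G := by positivity
  have hfe : ‖f‖ ≤ √e := le_sqrt_of_sq_le hf2
  have hrest : 0 ≤ (n : ℝ) ^ lam * r ^ (-lam) * (e * e') := by positivity
  rcases le_or_gt 1 r with hr1 | hr1
  · calc |inner ℝ (proj n f) g| ≤ ‖proj n f‖ * ‖proj n g‖ := by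
          rw [proj_inner_symm (hproj n)]; exact abs_real_inner_le_norm _ _
      _ ≤ √e * √(C1 * G) := by
          gcongr
          · exact (proj_norm_le (hproj n) f).trans hfe
          · exact le_sqrt_of_sq_le (h1 n hn n le_rfl g e' hg)
      _ = √C1 * √(1 * e * G) := by
          rw [sqrt_mul hC1.le, one_mul, sqrt_mul he.le]; ring
      _ ≤ (√C1 + C * √(C * C1) + C * 2 ^ lam) *
          (√(r * e * G) + (n : ℝ) ^ lam * r ^ (-lam) * (e * e')) := by
          have : 0 ≤ C * √(C * C1) + C * 2 ^ lam := by positivity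
          have : √(1 * e * G) ≤ √(r * e * G) := by gcongr
          gcongr <;> linarith
  · obtain ⟨M, hM, hM1, hM2⟩ := exists_nat_inv_le hr hr1
    have hM0 : (0 : ℝ) < M := by exact_mod_cast hM
    obtain ⟨s, hs1, hs2, hs⟩ := h n hn n le_rfl M hM
    have hsum : ∑ l ∈ s, |inner ℝ (proj l f) g| ≤ √e * √(C * M * (C1 * G)) := by
      calc ∑ l ∈ s, |inner ℝ (proj l f) g| ≤ ∑ l ∈ s, ‖proj l f‖ * ‖proj l g‖ :=
            sum_le_sum fun l _ => by
              rw [proj_inner_symm (hproj l)]; exact abs_real_inner_le_norm _ _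
        _ ≤ √(∑ l ∈ s, ‖proj l f‖ ^ 2) * √(∑ l ∈ s, ‖proj l g‖ ^ 2) :=
            sum_mul_le_sqrt_mul_sqrt _ _ _
        _ ≤ _ := by
            gcongr
            · exact (proj_bessel hd hproj s f).trans hf2
            · calc ∑ l ∈ s, ‖proj l g‖ ^ 2 ≤ ∑ l ∈ s, C1 * G :=
                    sum_le_sum fun l hl' => h1 n hn l (hs2 l hl') g e' hg
                _ = s.card * (C1 * G) := by simp
                _ ≤ _ := by gcongr
    have hf0 : 0 ≤ ∫ x, |f x| ∂(sphMeasure d) := integral_nonneg fun _ => abs_nonneg _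
    have hg0 : 0 ≤ ∫ x, |g x| ∂(sphMeasure d) := integral_nonneg fun _ => abs_nonneg _
    have e1 : C / M * (√e * √(C * M * (C1 * G))) = C * √(C * C1) * √((M : ℝ)⁻¹ * e * G) := by
      rw [show C * M * (C1 * G) = (C * C1) * (M * G) by ring, sqrt_mul (by positivity) (M * G),
        sqrt_mul hM0.le, mul_assoc _ e,
        sqrt_mul hC.le C1, sqrt_mul (inv_nonneg.2 hM0.le), sqrt_mul he.le, sqrt_inv]
      have : (M : ℝ) = √M * √M := (mul_self_sqrt hM0.le).symm
      have h0 : 0 < √(M : ℝ) := sqrt_pos.2 hM0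
      rw [div_eq_mul_inv]
      nth_rewrite 1 [this]
      field_simp
    calc |inner ℝ (proj n f) g| ≤ C / M * (√e * √(C * M * (C1 * G))) +
          C * (M : ℝ) ^ lam * (n : ℝ) ^ lam * (e * e') :=
          (hs f g).trans (by gcongr; exact hg.2.2)
      _ ≤ C * √(C * C1) * √(r * e * G) + C * (2 * r⁻¹) ^ lam * (n : ℝ) ^ lam * (e * e') := by
          rw [e1]; gcongr
      _ = C * √(C * C1) * √(r * e * G) +
          C * 2 ^ lam * ((n : ℝ) ^ lam * r ^ (-lam) * (e * e')) := by
          rw [mul_rpow (by norm_num) (by positivity), inv_rpow hr.le, rpow_neg hr.le]; ring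
      _ ≤ (√C1 + C * √(C * C1) + C * 2 ^ lam) * √(r * e * G) + (√C1 + C * √(C * C1) +
          C * 2 ^ lam) * ((n : ℝ) ^ lam * r ^ (-lam) * (e * e')) := by
          have h2 : 0 ≤ √C1 := by positivity
          have h3 : 0 ≤ C * √(C * C1) := by positivity
          have h4 : 0 ≤ C * 2 ^ lam := by positivity
          gcongr <;> linarith
      _ = _ := by ring

/-- Restricted bilinear bound at the endpoint exponent. -/
lemma exists_abs_inner_proj_le_endpoint (hd : 3 ≤ d) (hlam : (d : ℝ) = 2 * lam + 2) (hl : 0 < lam)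
    (hproj : ∀ k, IsOrthProjOnto d k (proj k)) :
    ∃ C : ℝ, 0 < C ∧ ∀ n : ℕ, 1 ≤ n → ∀ f e, BumpBound f e → ∀ g e', BumpBound g e' →
      |inner ℝ (proj n f) g| ≤ C * ((n : ℝ) ^ (lam / (1 + lam)) *
        e ^ ((1 + lam) / (1 + 2 * lam)) *
        e' ^ ((1 + 3 * lam + lam ^ 2) / ((1 + lam) * (1 + 2 * lam)))) := by
  obtain ⟨C, hC, h⟩ := exists_abs_inner_proj_le_of_bump hd hlam hl hproj
  refine ⟨2 * C, by positivity, fun n hn f e hf g e' hg => ?_⟩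
  have he := hf.1
  have he' := hg.1
  have hn' : (0 : ℝ) < n := by exact_mod_cast hn
  refine (h n hn f e hf g e' hg (((n : ℝ) ^ lam * e) ^ (1 / (1 + 2 * lam)) *
    ((n : ℝ) ^ lam * e') ^ (lam / ((1 + lam) * (1 + 2 * lam)))) (by positivity)).trans
    (le_of_eq ?_)
  rw [mul_comm 2 C, mul_assoc C 2, two_mul ((n : ℝ) ^ (lam / (1 + lam)) * _ * _)]
  congr 1
  rw [sqrt_eq_rpow]
  obtain ⟨x, hx⟩ : ∃ x, exp x = n := ⟨log n, exp_log hn'⟩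
  obtain ⟨y, rfl⟩ : ∃ y, exp y = e := ⟨log e, exp_log he⟩
  obtain ⟨z, rfl⟩ : ∃ z, exp z = e' := ⟨log e', exp_log he'⟩
  rw [← hx]
  simp only [← exp_mul, ← exp_add]
  have h1 : 1 + lam ≠ 0 := by positivity
  have h2 : 1 + 2 * lam ≠ 0 := by positivity
  congr 2 <;> field_simp <;> ring

/-- Off-diagonal restricted bilinear bound for exponents up to the endpoint. -/
lemma exists_abs_inner_proj_le_interpolated (hd : 3 ≤ d) (hlam : (d : ℝ) = 2 * lam + 2)
    (hl : 0 < lam) (hproj : ∀ k, IsOrthProjOnto d k (proj k)) {q : ℝ} (hq1 : q < 1)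
    (hq0 : (lam + 2) / (2 * (lam + 1)) ≤ q) :
    ∃ C : ℝ, 0 < C ∧ ∃ δ : ℝ, 0 < δ ∧ δ < q ∧ ∀ n : ℕ, 1 ≤ n → ∀ f e, BumpBound f e →
      ∀ g e', BumpBound g e' → |inner ℝ (proj n f) g| ≤
        C * (n : ℝ) ^ (2 * ((2 * lam + 1) * (q - 1 / 2) - 1 / 2)) *
          (e ^ (q - δ) * e' ^ (q + δ)) := by
  obtain ⟨C0, hC0, h0⟩ := exists_abs_inner_proj_le_endpoint hd hlam hl hproj
  obtain ⟨C1, hC1, h1⟩ := exists_abs_inner_proj_le hd hlam hl hproj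
  have hq2 : lam + 2 ≤ q * (2 * (lam + 1)) := (div_le_iff₀ (by positivity)).1 hq0
  have hqh : 1 / 2 < q := lt_of_lt_of_le
    (by rw [div_lt_div_iff₀ (by norm_num) (by positivity)]; linarith) hq0
  set θ := (1 - q) * (2 * (lam + 1)) / lam with hθ
  have hθ0 : 0 ≤ θ := by
    have : 0 ≤ 1 - q := by linarith
    positivity
  have hθ1 : θ ≤ 1 := by rw [hθ, div_le_one hl]; linarith
  refine ⟨C0 ^ θ * C1 ^ (1 - θ), by positivity, (1 - q) / (1 + 2 * lam),
    div_pos (by linarith) (by positivity), ?_, fun n hn f e hf g e' hg => ?_⟩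
  · rw [div_lt_iff₀ (by positivity)]; nlinarith
  have he := hf.1
  have he' := hg.1
  have hn' : (0 : ℝ) < n := by exact_mod_cast hn
  have b0 := h0 n hn f e hf g e' hg
  have b1 : |inner ℝ (proj n f) g| ≤ C1 * (n : ℝ) ^ (2 * lam) * (e * e') := by
    refine (h1 n hn f g).trans ?_
    have hg0 : 0 ≤ ∫ x, |g x| ∂(sphMeasure d) := integral_nonneg fun _ => abs_nonneg _
    gcongr
    · exact hf.2.2
    · exact hg.2.2
  have hX := abs_nonneg (inner ℝ (proj n f) g)
  generalize |inner ℝ (proj n f) g| = X at *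
  have eX : X = X ^ θ * X ^ (1 - θ) := by
    rw [← rpow_add' hX (by rw [add_sub_cancel]; norm_num), add_sub_cancel, rpow_one]
  rw [eX]
  refine (mul_le_mul (rpow_le_rpow hX b0 hθ0) (rpow_le_rpow hX b1 (by linarith)) (by positivity)
    (by positivity)).trans (le_of_eq ?_)
  rw [mul_rpow hC0.le (by positivity), mul_assoc C1, mul_rpow hC1.le (by positivity),
    mul_mul_mul_comm, mul_assoc (_ * _)]
  congr 1
  obtain ⟨x, hx⟩ : ∃ x, exp x = n := ⟨log n, exp_log hn'⟩
  obtain ⟨y, rfl⟩ : ∃ y, exp y = e := ⟨log e, exp_log he⟩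
  obtain ⟨z, rfl⟩ : ∃ z, exp z = e' := ⟨log e', exp_log he'⟩
  rw [← hx]
  simp only [← exp_mul, ← exp_add]
  have h1 : 1 + lam ≠ 0 := by positivity
  have h2 : 1 + 2 * lam ≠ 0 := by positivity
  rw [hθ]
  congr 1; field_simp; ring

end RestrictedBounds

section DyadicSum

open Finset Real

lemma sum_pow_natAbs_le {ρ : ℝ} (h0 : 0 ≤ ρ) (h1 : ρ < 1) (s : Finset ℤ) (k : ℤ) :
    ∑ m ∈ s, ρ ^ (k - m).natAbs ≤ 2 * (1 - ρ)⁻¹ := by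
  have key : ∀ t : Finset ℤ, Set.InjOn (fun m => (k - m).natAbs) (t : Set ℤ) →
      ∑ m ∈ t, ρ ^ (k - m).natAbs ≤ (1 - ρ)⁻¹ := by
    intro t ht
    rw [← sum_image (f := fun j => ρ ^ j) ht, ← tsum_geometric_of_lt_one h0 h1]
    exact (summable_geometric_of_lt_one h0 h1).sum_le_tsum _ fun i _ => by positivity
  rw [← sum_filter_add_sum_filter_not s (fun m => m ≤ k), two_mul]
  refine add_le_add (key _ ?_) (key _ ?_)
  · intro i hi j hj hij
    simp only [coe_filter, Set.mem_ofPred_eq] at hi hj hij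
    omega
  · intro i hi j hj hij
    simp only [coe_filter, Set.mem_ofPred_eq] at hi hj hij
    omega

lemma sum_rpow_le_rpow_sum {ι : Type*} (s : Finset ι) {A : ι → ℝ} (hA : ∀ i, 0 ≤ A i) {r : ℝ}
    (hr : 1 ≤ r) : ∑ i ∈ s, A i ^ r ≤ (∑ i ∈ s, A i) ^ r := by
  have e : ∀ x : ℝ, 0 ≤ x → x ^ r = x * x ^ (r - 1) := fun x hx => by
    rw [← rpow_one_add' hx (by linarith), add_sub_cancel]
  rw [e _ (sum_nonneg fun i _ => hA i), sum_mul]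
  refine sum_le_sum fun i hi => ?_
  rw [e _ (hA i)]
  refine mul_le_mul_of_nonneg_left (rpow_le_rpow (hA i) ?_ (by linarith)) (hA i)
  exact single_le_sum (fun j _ => hA j) hi

lemma sum_sum_pow_natAbs_mul_le {ρ r : ℝ} (h0 : 0 ≤ ρ) (h1 : ρ < 1) (hr : 1 ≤ r) (s : Finset ℤ)
    {A : ℤ → ℝ} (hA : ∀ i, 0 ≤ A i) :
    ∑ k ∈ s, ∑ m ∈ s, ρ ^ (k - m).natAbs * (A k ^ r + A m ^ r) ≤
      4 * (1 - ρ)⁻¹ * (∑ k ∈ s, A k) ^ r := by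
  have key : ∑ k ∈ s, ∑ m ∈ s, ρ ^ (k - m).natAbs * A k ^ r ≤
      2 * (1 - ρ)⁻¹ * (∑ k ∈ s, A k) ^ r := by
    have hρ : 0 ≤ (1 - ρ)⁻¹ := inv_nonneg.2 (by linarith)
    calc _ ≤ ∑ k ∈ s, 2 * (1 - ρ)⁻¹ * A k ^ r := by
          refine sum_le_sum fun k _ => ?_
          rw [← sum_mul]
          exact mul_le_mul_of_nonneg_right (sum_pow_natAbs_le h0 h1 s k) (rpow_nonneg (hA k) _)
      _ ≤ _ := by
          rw [← mul_sum]
          exact mul_le_mul_of_nonneg_left (sum_rpow_le_rpow_sum s hA hr) (by positivity)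
  have key2 : ∑ k ∈ s, ∑ m ∈ s, ρ ^ (k - m).natAbs * A m ^ r =
      ∑ k ∈ s, ∑ m ∈ s, ρ ^ (k - m).natAbs * A k ^ r := by
    rw [sum_comm]
    refine sum_congr rfl fun k _ => sum_congr rfl fun m _ => ?_
    rw [← Int.natAbs_neg, neg_sub]
  simp only [mul_add, sum_add_distrib]
  rw [key2]
  linarith

lemma rpow_mul_rpow_le_add {x y a b : ℝ} (hx : 0 ≤ x) (hy : 0 ≤ y) (ha : 0 ≤ a) (hb : 0 ≤ b)
    (hab : a + b ≠ 0) : x ^ a * y ^ b ≤ x ^ (a + b) + y ^ (a + b) := by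
  rcases le_total x y with h | h
  · calc x ^ a * y ^ b ≤ y ^ a * y ^ b := by gcongr
      _ = y ^ (a + b) := (rpow_add' hy hab).symm
      _ ≤ _ := le_add_of_nonneg_left (rpow_nonneg hx _)
  · calc x ^ a * y ^ b ≤ x ^ a * x ^ b := by gcongr
      _ = x ^ (a + b) := (rpow_add' hx hab).symm
      _ ≤ _ := le_add_of_nonneg_right (rpow_nonneg hy _)

/-- The off-diagonal decay of restricted bounds applied to dyadic levels. -/
lemma two_zpow_mul_rpow_le {p q δ : ℝ} (hpq : p * q = 1) (hδ0 : 0 < δ) (hδ : δ < q)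
    {k m : ℤ} (hkm : k ≤ m) {e e' : ℝ} (he : 0 < e) (he' : 0 < e') :
    (2 : ℝ) ^ k * 2 ^ m * (e ^ (q - δ) * e' ^ (q + δ)) ≤
      ((2 : ℝ) ^ (-(p * δ))) ^ (k - m).natAbs *
        (((2 : ℝ) ^ (p * k) * e) ^ (2 * q) + ((2 : ℝ) ^ (p * m) * e') ^ (2 * q)) := by
  have h := rpow_mul_rpow_le_add (x := (2 : ℝ) ^ (p * k) * e) (y := (2 : ℝ) ^ (p * m) * e')
    (a := q - δ) (b := q + δ) (by positivity) (by positivity) (by linarith) (by linarith)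
    (by linarith)
  rw [show q - δ + (q + δ) = 2 * q by ring] at h
  refine le_trans (le_of_eq ?_) (mul_le_mul_of_nonneg_left h (by positivity))
  have hc : (((k - m).natAbs : ℕ) : ℝ) = m - k := by
    have h : |k - m| = m - k := by rw [abs_sub_comm, abs_of_nonneg (by omega)]
    rw [Nat.cast_natAbs, h, Int.cast_sub]
  rw [← rpow_natCast, hc, ← rpow_intCast, ← rpow_intCast]
  obtain ⟨y, rfl⟩ : ∃ y, exp y = e := ⟨log e, exp_log he⟩
  obtain ⟨z, rfl⟩ : ∃ z, exp z = e' := ⟨log e', exp_log he'⟩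
  obtain ⟨x, hx⟩ : ∃ x, exp x = 2 := ⟨log 2, exp_log (by norm_num)⟩
  rw [← hx]
  simp only [← exp_mul, ← exp_add]
  congr 1
  linear_combination (-x * (k + m)) * hpq

end DyadicSum

section DyadicParts

open Finset Real

variable {d : ℕ}

lemma proj_smul {k : ℕ} {T : Lp ℝ 2 (sphMeasure d) → Lp ℝ 2 (sphMeasure d)}
    (hT : IsOrthProjOnto d k T) (c : ℝ) (f : Lp ℝ 2 (sphMeasure d)) : T (c • f) = c • T f := by
  have h : T (c • f) - c • T f ∈ Hspace d k :=
    Submodule.sub_mem _ (hT _).1 (Submodule.smul_mem _ _ (hT _).1)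
  rw [← sub_eq_zero, ← inner_self_eq_zero (𝕜 := ℝ)]
  set u := T (c • f) - c • T f with hu
  have h1 := (hT f).2 _ h
  have h2 := (hT (c • f)).2 _ h
  have e : u = c • (f - T f) - (c • f - T (c • f)) := by rw [hu, smul_sub]; abel
  nth_rewrite 1 [e]
  rw [inner_sub_left, real_inner_smul_left, h1, h2]
  simp

lemma proj_sum {k : ℕ} {T : Lp ℝ 2 (sphMeasure d) → Lp ℝ 2 (sphMeasure d)}
    (hT : IsOrthProjOnto d k T) {ι : Type*} (s : Finset ι) (f : ι → Lp ℝ 2 (sphMeasure d)) :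
    T (∑ i ∈ s, f i) = ∑ i ∈ s, T (f i) := by
  classical
  induction s using Finset.induction_on with
  | empty => simpa using proj_smul hT 0 0
  | insert i s hi ih => rw [sum_insert hi, sum_insert hi, proj_add hT, ih]

/-- The set where `|f|` is of size between `2 ^ k` and `2 ^ (k + 1)`. -/
def dyadicSet (f : Lp ℝ 2 (sphMeasure d)) (k : ℤ) : Set (Sph d) :=
  {x | (2 : ℝ) ^ k ≤ |f x| ∧ |f x| < (2 : ℝ) ^ (k + 1)}

lemma measurableSet_dyadicSet (f : Lp ℝ 2 (sphMeasure d)) (k : ℤ) :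
    MeasurableSet (dyadicSet f k) := by
  have hf : Measurable fun x => |f x| := (Lp.stronglyMeasurable f).measurable.abs
  exact (measurableSet_le measurable_const hf).inter (measurableSet_lt hf measurable_const)

/-- The part of `f` where `|f|` is of size between `2 ^ k` and `2 ^ (k + 1)`. -/
def dyadicPart (f : Lp ℝ 2 (sphMeasure d)) (k : ℤ) : Lp ℝ 2 (sphMeasure d) :=
  ((Lp.memLp f).indicator (measurableSet_dyadicSet f k)).toLp _

lemma coeFn_dyadicPart (f : Lp ℝ 2 (sphMeasure d)) (k : ℤ) :
    dyadicPart f k =ᵐ[sphMeasure d] (dyadicSet f k).indicator f :=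
  MemLp.coeFn_toLp _

lemma coeFn_sum_dyadicPart (f : Lp ℝ 2 (sphMeasure d)) (s : Finset ℤ) :
    (∑ k ∈ s, dyadicPart f k : Lp ℝ 2 (sphMeasure d)) =ᵐ[sphMeasure d]
      fun x => ∑ k ∈ s, (dyadicSet f k).indicator f x := by
  induction s using Finset.induction_on with
  | empty => simp only [sum_empty]; exact Lp.coeFn_zero ℝ 2 (sphMeasure d)
  | insert k s hk ih =>
    simp only [sum_insert hk]
    filter_upwards [Lp.coeFn_add (dyadicPart f k) (∑ k ∈ s, dyadicPart f k), ih,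
      coeFn_dyadicPart f k] with x h1 h2 h3
    rw [h1, Pi.add_apply, h2, h3]

lemma mem_dyadicSet_iff (f : Lp ℝ 2 (sphMeasure d)) (k : ℤ) {x : Sph d} (hx : f x ≠ 0) :
    x ∈ dyadicSet f k ↔ Int.log 2 |f x| = k := by
  have hx' : 0 < |f x| := abs_pos.2 hx
  have h1 := Int.zpow_le_iff_le_log (b := 2) (by norm_num) (x := k) hx'
  have h2 := Int.lt_zpow_iff_log_lt (b := 2) (by norm_num) (x := k + 1) hx'
  push_cast at h1 h2
  rw [dyadicSet, Set.mem_ofPred_eq, h1, h2]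
  omega

lemma notMem_dyadicSet (f : Lp ℝ 2 (sphMeasure d)) (k : ℤ) {x : Sph d} (hx : f x = 0) :
    x ∉ dyadicSet f k := by
  rintro ⟨h, -⟩
  rw [hx, abs_zero] at h
  exact absurd h (not_le.2 (by positivity))

lemma sum_indicator_dyadicSet (f : Lp ℝ 2 (sphMeasure d)) (s : Finset ℤ) (x : Sph d)
    (φ : Sph d → ℝ) (hφ : f x = 0 → φ x = 0) :
    ∑ k ∈ s, (dyadicSet f k).indicator φ x = if Int.log 2 |f x| ∈ s then φ x else 0 := by
  by_cases hx : f x = 0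
  · rw [hφ hx, ite_self]
    exact sum_eq_zero fun k _ => Set.indicator_of_notMem (notMem_dyadicSet f k hx) _
  · rw [← sum_ite_eq s (Int.log 2 |f x|) fun _ => φ x]
    refine sum_congr rfl fun k _ => ?_
    by_cases hk : Int.log 2 |f x| = k
    · rw [if_pos hk, Set.indicator_of_mem ((mem_dyadicSet_iff f k hx).2 hk)]
    · rw [if_neg hk, Set.indicator_of_notMem fun h => hk ((mem_dyadicSet_iff f k hx).1 h)]

lemma tendsto_sum_dyadicPart (f : Lp ℝ 2 (sphMeasure d)) :
    Filter.Tendsto (fun N : ℕ => ‖f - ∑ k ∈ Icc (-(N : ℤ)) N, dyadicPart f k‖ ^ 2)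
      Filter.atTop (nhds 0) := by
  have e : ∀ N : ℕ, ‖f - ∑ k ∈ Icc (-(N : ℤ)) N, dyadicPart f k‖ ^ 2 =
      ∫ x, (if Int.log 2 |f x| ∈ Icc (-(N : ℤ)) N then 0 else (f x) ^ 2) ∂(sphMeasure d) := by
    intro N
    rw [← real_inner_self_eq_norm_sq, L2.inner_def]
    refine integral_congr_ae ?_
    filter_upwards [Lp.coeFn_sub f (∑ k ∈ Icc (-(N : ℤ)) N, dyadicPart f k),
      coeFn_sum_dyadicPart f (Icc (-(N : ℤ)) N)] with x h1 h2
    rw [h1, Pi.sub_apply, h2, sum_indicator_dyadicSet f _ x f id, real_inner_self_eq_norm_sq,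
      Real.norm_eq_abs, sq_abs]
    split_ifs <;> simp
  simp only [e]
  suffices h : Filter.Tendsto (fun N : ℕ => ∫ x,
      (if Int.log 2 |f x| ∈ Icc (-(N : ℤ)) N then 0 else (f x) ^ 2) ∂(sphMeasure d))
      Filter.atTop (nhds (∫ _, (0 : ℝ) ∂(sphMeasure d))) by simpa only [integral_zero] using h
  have hm : Measurable f := (Lp.stronglyMeasurable f).measurable
  refine tendsto_integral_of_dominated_convergence (fun x => (f x) ^ 2) (fun N => ?_)
    (Lp.memLp f).integrable_sq (fun N => ?_) ?_
  · have hs : MeasurableSet {x : Sph d | Int.log 2 |f x| ∈ Icc (-(N : ℤ)) N} := by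
      have e : {x : Sph d | Int.log 2 |f x| ∈ Icc (-(N : ℤ)) N} =
          (⋃ k ∈ Icc (-(N : ℤ)) N, dyadicSet f k) ∪ {x | f x = 0} := by
        ext x
        by_cases hx : f x = 0
        · simp [hx]
        · simp [hx, mem_dyadicSet_iff f _ hx]
      rw [e]
      exact (Finset.measurableSet_biUnion _ fun k _ => measurableSet_dyadicSet f k).union
        (hm (measurableSet_singleton 0))
    exact (Measurable.ite hs measurable_const (hm.pow_const 2)).aestronglyMeasurable
  · refine Filter.Eventually.of_forall fun x => ?_
    split_ifs
    · simpa using sq_nonneg (f x)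
    · simp
  · refine Filter.Eventually.of_forall fun x => ?_
    refine tendsto_const_nhds.congr' ?_
    filter_upwards [Filter.eventually_ge_atTop (Int.log 2 |f x|).natAbs] with N hN
    rw [if_pos]
    rw [mem_Icc]
    omega

lemma bumpBound_of_ae_le {g : Lp ℝ 2 (sphMeasure d)} {E : Set (Sph d)} (hE : MeasurableSet E)
    (hE0 : 0 < (sphMeasure d).real E)
    (hg : ∀ᵐ x ∂(sphMeasure d), |g x| ≤ E.indicator (fun _ => 1) x) :
    BumpBound g ((sphMeasure d).real E) := by
  have hi : ∫ x, E.indicator (fun _ => (1 : ℝ)) x ∂(sphMeasure d) = (sphMeasure d).real E := by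
    rw [integral_indicator hE]; simp
  have hint : Integrable (E.indicator fun _ => (1 : ℝ)) (sphMeasure d) :=
    (integrable_const 1).indicator hE
  refine ⟨hE0, ?_, ?_⟩
  · rw [← real_inner_self_eq_norm_sq, L2.inner_def, ← hi]
    refine integral_mono_of_nonneg (Filter.Eventually.of_forall fun x => real_inner_self_nonneg)
      hint ?_
    filter_upwards [hg] with x hx
    rw [real_inner_self_eq_norm_sq, Real.norm_eq_abs]
    have h1 : E.indicator (fun _ => (1 : ℝ)) x ≤ 1 := Set.indicator_le_self' (by simp) x
    calc |g x| ^ 2 ≤ |g x| := pow_le_of_le_one (abs_nonneg _) (hx.trans h1) (by norm_num)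
      _ ≤ _ := hx
  · rw [← hi]
    exact integral_mono_of_nonneg (Filter.Eventually.of_forall fun x => abs_nonneg _) hint hg

lemma bumpBound_dyadicPart (f : Lp ℝ 2 (sphMeasure d)) (k : ℤ)
    (h0 : 0 < (sphMeasure d).real (dyadicSet f k)) :
    BumpBound (((2 : ℝ) ^ (k + 1))⁻¹ • dyadicPart f k) ((sphMeasure d).real (dyadicSet f k)) := by
  refine bumpBound_of_ae_le (measurableSet_dyadicSet f k) h0 ?_
  filter_upwards [Lp.coeFn_smul ((2 : ℝ) ^ (k + 1))⁻¹ (dyadicPart f k), coeFn_dyadicPart f k]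
    with x h1 h2
  rw [h1, Pi.smul_apply, h2, smul_eq_mul]
  by_cases hx : x ∈ dyadicSet f k
  · rw [Set.indicator_of_mem hx, Set.indicator_of_mem hx, abs_mul, abs_inv,
      abs_of_pos (by positivity), inv_mul_le_iff₀ (by positivity), mul_one]
    exact hx.2.le
  · simp [hx]

lemma dyadicPart_eq_zero (f : Lp ℝ 2 (sphMeasure d)) (k : ℤ)
    (h0 : (sphMeasure d).real (dyadicSet f k) = 0) : dyadicPart f k = 0 := by
  have h : sphMeasure d (dyadicSet f k) = 0 := by
    rwa [Measure.real, ENNReal.toReal_eq_zero_iff, or_iff_left (measure_ne_top _ _)] at h0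
  refine Lp.ext ?_
  filter_upwards [coeFn_dyadicPart f k, Lp.coeFn_zero ℝ 2 (sphMeasure d),
    measure_eq_zero_iff_ae_notMem.1 h] with x h1 h2 h3
  rw [h1, h2, Set.indicator_of_notMem h3]; rfl

lemma sum_rpow_mul_measure_dyadicSet_le {p : ℝ} (hp : 0 < p) (f : Lp ℝ 2 (sphMeasure d))
    (hf : Integrable (fun x => |f x| ^ p) (sphMeasure d)) (s : Finset ℤ) :
    ∑ k ∈ s, (2 : ℝ) ^ (p * k) * (sphMeasure d).real (dyadicSet f k) ≤
      ∫ x, |f x| ^ p ∂(sphMeasure d) := by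
  have hint : ∀ k ∈ s, Integrable ((dyadicSet f k).indicator fun x => |f x| ^ p) (sphMeasure d) :=
    fun k _ => hf.indicator (measurableSet_dyadicSet f k)
  calc _ ≤ ∑ k ∈ s, ∫ x, (dyadicSet f k).indicator (fun x => |f x| ^ p) x ∂(sphMeasure d) := by
        refine sum_le_sum fun k hk => ?_
        rw [mul_comm, ← smul_eq_mul, ← integral_indicator_const _ (measurableSet_dyadicSet f k)]
        refine integral_mono ((integrable_const _).indicator (measurableSet_dyadicSet f k))
          (hint k hk) fun x => Set.indicator_le_indicator' fun hx => ?_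
        rw [mul_comm, rpow_mul (by norm_num), rpow_intCast]
        exact rpow_le_rpow (by positivity) hx.1 hp.le
    _ = ∫ x, ∑ k ∈ s, (dyadicSet f k).indicator (fun x => |f x| ^ p) x ∂(sphMeasure d) :=
        (integral_finsetSum _ hint).symm
    _ ≤ _ := by
        refine integral_mono (integrable_finsetSum _ hint) hf fun x => ?_
        dsimp only
        rw [sum_indicator_dyadicSet f s x (fun x => |f x| ^ p) fun h => by
          rw [h, abs_zero, zero_rpow hp.ne']]
        split_ifs
        · exact le_rfl
        · positivity

end DyadicParts

section LebesgueBound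

open Finset Real

variable {d : ℕ}

lemma inner_proj_comm {k : ℕ} {T : Lp ℝ 2 (sphMeasure d) → Lp ℝ 2 (sphMeasure d)}
    (hT : IsOrthProjOnto d k T) (f g : Lp ℝ 2 (sphMeasure d)) :
    inner ℝ (T f) g = inner ℝ (T g) f := by
  rw [proj_inner_symm hT, real_inner_comm, ← proj_inner_symm hT]

lemma inner_proj_sum {k : ℕ} {T : Lp ℝ 2 (sphMeasure d) → Lp ℝ 2 (sphMeasure d)}
    (hT : IsOrthProjOnto d k T) {ι : Type*} (s : Finset ι) (f : ι → Lp ℝ 2 (sphMeasure d)) :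
    ‖T (∑ i ∈ s, f i)‖ ^ 2 = ∑ i ∈ s, ∑ j ∈ s, inner ℝ (T (f i)) (f j) := by
  rw [proj_norm_sq hT, proj_sum hT, sum_inner]
  exact sum_congr rfl fun i _ => inner_sum _ _ _

lemma abs_inner_proj_dyadicPart_le {n : ℕ} {T : Lp ℝ 2 (sphMeasure d) → Lp ℝ 2 (sphMeasure d)}
    (hT : IsOrthProjOnto d n T) {p q δ K : ℝ} (hpq : p * q = 1) (hδ0 : 0 < δ) (hδ : δ < q)
    (hK : 0 ≤ K) (h : ∀ f e, BumpBound f e → ∀ g e', BumpBound g e' →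
      |inner ℝ (T f) g| ≤ K * (e ^ (q - δ) * e' ^ (q + δ)))
    (f : Lp ℝ 2 (sphMeasure d)) (k m : ℤ) :
    |inner ℝ (T (dyadicPart f k)) (dyadicPart f m)| ≤
      4 * K * (((2 : ℝ) ^ (-(p * δ))) ^ (k - m).natAbs *
        (((2 : ℝ) ^ (p * k) * (sphMeasure d).real (dyadicSet f k)) ^ (2 * q) +
          ((2 : ℝ) ^ (p * m) * (sphMeasure d).real (dyadicSet f m)) ^ (2 * q))) := by
  wlog hkm : k ≤ m generalizing k m
  · have := this m k (by omega)
    rw [inner_proj_comm hT, add_comm, ← Int.natAbs_neg, neg_sub]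
    exact this
  have hT0 : T 0 = 0 := by simpa using proj_smul hT 0 0
  rcases (measureReal_nonneg (μ := sphMeasure d) (s := dyadicSet f k)).eq_or_lt' with hk | hk
  · rw [dyadicPart_eq_zero f k hk, hT0, inner_zero_left, abs_zero]
    positivity
  rcases (measureReal_nonneg (μ := sphMeasure d) (s := dyadicSet f m)).eq_or_lt' with hm | hm
  · rw [dyadicPart_eq_zero f m hm, inner_zero_right, abs_zero]
    positivity
  have h1 := h _ _ (bumpBound_dyadicPart f k hk) _ _ (bumpBound_dyadicPart f m hm)
  rw [proj_smul hT, real_inner_smul_left, real_inner_smul_right, abs_mul, abs_mul, abs_inv,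
    abs_inv, abs_of_pos (by positivity : (0 : ℝ) < 2 ^ (k + 1)),
    abs_of_pos (by positivity : (0 : ℝ) < 2 ^ (m + 1)), inv_mul_le_iff₀ (by positivity),
    inv_mul_le_iff₀ (by positivity), zpow_add_one₀ (by norm_num),
    zpow_add_one₀ (by norm_num)] at h1
  have h2 := mul_le_mul_of_nonneg_left (two_zpow_mul_rpow_le hpq hδ0 hδ hkm hk hm)
    (by positivity : 0 ≤ 4 * K)
  refine (h1.trans_eq ?_).trans h2
  ring

lemma exists_norm_proj_sq_le_integral_rpow {lam p q : ℝ} (hd : 3 ≤ d)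
    (hlam : (d : ℝ) = 2 * lam + 2) (hl : 0 < lam)
    {proj : ℕ → Lp ℝ 2 (sphMeasure d) → Lp ℝ 2 (sphMeasure d)}
    (hproj : ∀ k, IsOrthProjOnto d k (proj k)) (hpq : p * q = 1) (hp1 : 1 ≤ p)
    (hq0 : (lam + 2) / (2 * (lam + 1)) ≤ q) :
    ∃ C : ℝ, 0 < C ∧ ∀ n : ℕ, 1 ≤ n → ∀ f : Lp ℝ 2 (sphMeasure d),
      Integrable (fun x => |f x| ^ p) (sphMeasure d) →
      ‖proj n f‖ ^ 2 ≤ C * (n : ℝ) ^ (2 * ((2 * lam + 1) * (q - 1 / 2) - 1 / 2)) *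
        (∫ x, |f x| ^ p ∂(sphMeasure d)) ^ (2 * q) := by
  rcases hp1.eq_or_lt with rfl | hp1
  · obtain rfl : q = 1 := by linarith
    obtain ⟨C, hC, h⟩ := exists_abs_inner_proj_le hd hlam hl hproj
    refine ⟨C, hC, fun n hn f _ => ?_⟩
    rw [proj_norm_sq (hproj n)]
    refine (le_abs_self _).trans ((h n hn f f).trans_eq ?_)
    simp only [rpow_one]
    rw [mul_one, rpow_two, sq]
    congr 3
    ring
  have hq : 0 < q := lt_of_lt_of_le (by positivity) hq0
  have hq1 : q < 1 := by nlinarith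
  have hq2 : 1 ≤ 2 * q := by
    have : (1 : ℝ) / 2 ≤ (lam + 2) / (2 * (lam + 1)) := by
      rw [div_le_div_iff₀ (by norm_num) (by positivity)]
      linarith
    linarith
  obtain ⟨C, hC, δ, hδ0, hδ, h⟩ :=
    exists_abs_inner_proj_le_interpolated hd hlam hl hproj hq1 hq0
  set ρ : ℝ := 2 ^ (-(p * δ)) with hρ
  have hρ0 : 0 ≤ ρ := by positivity
  have hρ1 : ρ < 1 := rpow_lt_one_of_one_lt_of_neg (by norm_num) (by
    have : 0 < p * δ := by positivity
    linarith)
  have hρ' : 0 < (1 - ρ)⁻¹ := inv_pos.2 (by linarith)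
  refine ⟨4 * C * (4 * (1 - ρ)⁻¹), by positivity, fun n hn f hf => ?_⟩
  set K : ℝ := C * (n : ℝ) ^ (2 * ((2 * lam + 1) * (q - 1 / 2) - 1 / 2)) with hK
  have hK0 : 0 ≤ K := by positivity
  set B : ℝ := 4 * K * (4 * (1 - ρ)⁻¹ * (∫ x, |f x| ^ p ∂(sphMeasure d)) ^ (2 * q)) with hB
  have hI : 0 ≤ ∫ x, |f x| ^ p ∂(sphMeasure d) := integral_nonneg fun x => by positivity
  have hB0 : 0 ≤ B := by positivity
  have hsum : ∀ s : Finset ℤ, ‖proj n (∑ k ∈ s, dyadicPart f k)‖ ^ 2 ≤ B := by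
    intro s
    rw [inner_proj_sum (hproj n)]
    calc _ ≤ ∑ k ∈ s, ∑ m ∈ s, 4 * K * (ρ ^ (k - m).natAbs *
          (((2 : ℝ) ^ (p * k) * (sphMeasure d).real (dyadicSet f k)) ^ (2 * q) +
            ((2 : ℝ) ^ (p * m) * (sphMeasure d).real (dyadicSet f m)) ^ (2 * q))) :=
          sum_le_sum fun k _ => sum_le_sum fun m _ => (le_abs_self _).trans
            (abs_inner_proj_dyadicPart_le (hproj n) hpq hδ0 hδ hK0 (h n hn) f k m)
      _ = 4 * K * ∑ k ∈ s, ∑ m ∈ s, (ρ ^ (k - m).natAbs *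
          (((2 : ℝ) ^ (p * k) * (sphMeasure d).real (dyadicSet f k)) ^ (2 * q) +
            ((2 : ℝ) ^ (p * m) * (sphMeasure d).real (dyadicSet f m)) ^ (2 * q))) := by
          simp only [mul_sum]
      _ ≤ 4 * K * (4 * (1 - ρ)⁻¹ *
          (∑ k ∈ s, (2 : ℝ) ^ (p * k) * (sphMeasure d).real (dyadicSet f k)) ^ (2 * q)) := by
          gcongr
          exact sum_sum_pow_natAbs_mul_le hρ0 hρ1 hq2 s
            (A := fun k : ℤ => (2 : ℝ) ^ (p * k) * (sphMeasure d).real (dyadicSet f k))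
            fun k => by positivity
      _ ≤ B := by
          rw [hB]
          gcongr
          exact sum_rpow_mul_measure_dyadicSet_le (by linarith) f hf s
  have hle : ‖proj n f‖ ≤ √B := by
    have ht := ((tendsto_sum_dyadicPart f).sqrt).add_const (√B)
    rw [sqrt_zero, zero_add] at ht
    refine ge_of_tendsto' ht fun N => ?_
    rw [sqrt_sq (norm_nonneg _)]
    set g := ∑ k ∈ Icc (-(N : ℤ)) N, dyadicPart f k with hg
    calc ‖proj n f‖ = ‖proj n (f - g) + proj n g‖ := by
          rw [← proj_add (hproj n), sub_add_cancel]
      _ ≤ ‖proj n (f - g)‖ + ‖proj n g‖ := norm_add_le _ _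
      _ ≤ _ := add_le_add (proj_norm_le (hproj n) _) (le_sqrt_of_sq_le (hsum _))
  calc ‖proj n f‖ ^ 2 ≤ (√B) ^ 2 := by gcongr
    _ = B := sq_sqrt hB0
    _ = _ := by rw [hB, hK]; ring

lemma toReal_le_of_le_endpoint (hd : 3 ≤ d) {p : ℝ≥0∞}
    (hp : p ≤ 1 + (((d : ℝ≥0∞) - 2) / 2) / ((((d : ℝ≥0∞) - 2) / 2) + 2)) :
    p ≠ ⊤ ∧ p.toReal ≤ 1 + (((d : ℝ) - 2) / 2) / ((((d : ℝ) - 2) / 2) + 2) := by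
  have h2 : (0 : ℝ) ≤ (d : ℝ) - 2 := by
    have : (3 : ℝ) ≤ d := by exact_mod_cast hd
    linarith
  have e : (1 + (((d : ℝ≥0∞) - 2) / 2) / ((((d : ℝ≥0∞) - 2) / 2) + 2)) =
      ENNReal.ofReal (1 + (((d : ℝ) - 2) / 2) / ((((d : ℝ) - 2) / 2) + 2)) := by
    rw [ENNReal.ofReal_add (by norm_num) (by positivity), ENNReal.ofReal_div_of_pos (by positivity),
      ENNReal.ofReal_add (by positivity) (by norm_num), ENNReal.ofReal_div_of_pos (by norm_num),
      ENNReal.ofReal_sub _ (by norm_num)]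
    simp
  rw [e] at hp
  exact ⟨ne_top_of_le_ne_top ENNReal.ofReal_ne_top hp,
    ENNReal.toReal_le_of_le_ofReal (by positivity) hp⟩

end LebesgueBound

/-- Lemma 2.1(i) (Sogge): if `1 ≤ p ≤ p_λ := 1 + λ/(λ+2)` with `λ = (d-2)/2`, then
`‖proj_n f‖_2 ≤ C n^{(2λ+1)(1/p - 1/2) - 1/2} ‖f‖_p` for all `f ∈ L²(S^{d-1}, σ)`. -/
theorem proj_bound_i
    (d : ℕ) (hd : 3 ≤ d) (p : ℝ≥0∞)
    (hp1 : 1 ≤ p)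
    (hp2 : p ≤ 1 + (((d : ℝ≥0∞) - 2) / 2) / ((((d : ℝ≥0∞) - 2) / 2) + 2))
    (proj : ℕ → Lp ℝ 2 (sphMeasure d) → Lp ℝ 2 (sphMeasure d))
    (hproj : ∀ k, IsOrthProjOnto d k (proj k)) :
    ∃ C : ℝ, 0 < C ∧ ∀ n : ℕ, 1 ≤ n → ∀ f : Lp ℝ 2 (sphMeasure d),
      eLpNorm (⇑(proj n f)) 2 (sphMeasure d) ≤
        ENNReal.ofReal
            (C * (n : ℝ) ^
              ((2 * (((d : ℝ) - 2) / 2) + 1) * (1 / p.toReal - 1 / 2) - 1 / 2)) *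
          eLpNorm (⇑f) p (sphMeasure d) := by
  obtain ⟨hpt, hpr⟩ := toReal_le_of_le_endpoint hd hp2
  set lam : ℝ := ((d : ℝ) - 2) / 2 with hlam'
  have hd3 : (3 : ℝ) ≤ d := by exact_mod_cast hd
  have hl : 0 < lam := by rw [hlam']; linarith
  have hlam : (d : ℝ) = 2 * lam + 2 := by rw [hlam']; ring
  have hp1' : 1 ≤ p.toReal := by
    simpa using (ENNReal.toReal_le_toReal ENNReal.one_ne_top hpt).2 hp1
  have hp0 : 0 < p.toReal := by linarith
  have hq0 : (lam + 2) / (2 * (lam + 1)) ≤ 1 / p.toReal := by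
    have e : 1 + lam / (lam + 2) = 2 * (lam + 1) / (lam + 2) := by field_simp; ring
    rw [e, le_div_iff₀ (by positivity)] at hpr
    rw [div_le_div_iff₀ (by positivity) hp0]
    linarith
  have hple : p ≤ 2 := by
    rw [← ENNReal.toReal_le_toReal hpt (by norm_num), ENNReal.toReal_ofNat]
    refine hpr.trans ?_
    have : lam / (lam + 2) ≤ 1 := (div_le_one (by positivity)).2 (by linarith)
    linarith
  obtain ⟨C, hC, h⟩ := exists_norm_proj_sq_le_integral_rpow hd hlam hl hproj
    (mul_one_div_cancel hp0.ne') hp1' hq0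
  refine ⟨√C, Real.sqrt_pos.2 hC, fun n hn f => ?_⟩
  have hfp : MemLp f p (sphMeasure d) := (Lp.memLp f).mono_exponent hple
  have hint := hfp.integrable_norm_rpow (by positivity) hpt
  have hn0 : (0 : ℝ) ≤ n := n.cast_nonneg
  have hI : 0 ≤ ∫ x, ‖f x‖ ^ p.toReal ∂(sphMeasure d) := integral_nonneg fun x => by positivity
  rw [hfp.eLpNorm_eq_integral_rpow_norm (by positivity) hpt, ← ENNReal.ofReal_mul (by positivity),
    ← Lp.enorm_def, ← ofReal_norm]
  refine ENNReal.ofReal_le_ofReal (le_of_sq_le_sq ?_ (by positivity))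
  refine (h n hn f hint).trans_eq ?_
  rw [mul_pow, mul_pow, Real.sq_sqrt hC.le, ← Real.rpow_natCast, ← Real.rpow_natCast,
    ← Real.rpow_mul hn0, ← Real.rpow_mul hI]
  simp only [Real.norm_eq_abs, one_div, Nat.cast_ofNat, mul_comm (2 : ℝ)]
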